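/- arXiv:1810.02016 — 2 statements merged into one kernel-verified Lean document; each statement's English description precedes it below -/
import Mathlib

section
/- Let (G_k) be a sequence of random bipartite multigraphs (probability distributions over edge lists) such that the number of distinct left vertices, the number of distinct right vertices, and the number of edges of G_k all tend to infinity as k → ∞. If (G_k) is asymptotically block-free of order 4, then (G_k) is asymptotically block-free of order s for every integer s ≥ 2. -/
open Finset

namespace FourPointTest

variable {N n m : ℕ}

/-- The set of ways to list the edges of the sample `A` (an `s`-subset of edge indices)
in an order that is nondecreasing by left endpoint. -/
def leftOrds (e : Fin N → Fin n × Fin m) (s : ℕ) (A : Finset (Fin N)) :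
    Finset (Fin s → Fin N) :=
  Finset.univ.filter fun g =>
    Function.Injective g ∧ (∀ i, g i ∈ A) ∧
      ∀ i j : Fin s, i ≤ j → (e (g i)).1 ≤ (e (g j)).1

/-- Given a listing `g` of sampled edges (sorted by left endpoint), the set of permutations
`σ` for which the right endpoints `v_{σ(1)} ≤ … ≤ v_{σ(s)}` are nondecreasing. -/
def rightPerms (e : Fin N → Fin n × Fin m) (s : ℕ) (g : Fin s → Fin N) :
    Finset (Equiv.Perm (Fin s)) :=
  Finset.univ.filter fun σ : Equiv.Perm (Fin s) =>
    ∀ i j : Fin s, i ≤ j → (e (g (σ i))).2 ≤ (e (g (σ j))).2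

/-- The probability that the induced permutation of a uniform random `s`-edge sample of the
bipartite multigraph with edge list `e` equals `σ`: choose an `s`-subset of edges uniformly,
then a uniform ordering of it that is nondecreasing by left endpoint, then a uniform
`σ` among those making the right endpoints nondecreasing. -/
noncomputable def inducedProb (e : Fin N → Fin n × Fin m) (s : ℕ)
    (σ : Equiv.Perm (Fin s)) : ℝ :=
  ((N.choose s : ℝ))⁻¹ *
    ∑ A ∈ Finset.powersetCard s (Finset.univ : Finset (Fin N)),
      ((leftOrds e s A).card : ℝ)⁻¹ *
        ∑ g ∈ leftOrds e s A,
          ((rightPerms e s g).card : ℝ)⁻¹ * (if σ ∈ rightPerms e s g then (1 : ℝ) else 0)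

section

open scoped Classical

/-- The rankings of the indices that refine the preorder given by the labels `f`. -/
noncomputable def rankings {α : Type*} [LinearOrder α] (f : Fin N → α) :
    Finset (Equiv.Perm (Fin N)) :=
  {a | ∀ p q, f p < f q → a p < a q}

/-- The listings of the elements of `A` along which the labels `f` are nondecreasing. -/
noncomputable def listings {α : Type*} [LinearOrder α] (f : Fin N → α) (s : ℕ)
    (A : Finset (Fin N)) : Finset (Fin s → Fin N) :=
  {g | Function.Injective g ∧ (∀ i, g i ∈ A) ∧ Monotone (f ∘ g)}

theorem rankings_nonempty {α : Type*} [LinearOrder α] (f : Fin N → α) :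
    (rankings f).Nonempty := by
  refine ⟨(Tuple.sort f)⁻¹, ?_⟩
  simp only [rankings, mem_filter, mem_univ, true_and]
  intro p q hpq
  by_contra! h
  have := Tuple.monotone_sort f h
  simp only [Function.comp_apply, Equiv.Perm.coe_inv, Equiv.apply_symm_apply] at this
  exact absurd hpq (not_lt.2 this)

theorem monotone_of_mem_rankings {α : Type*} [LinearOrder α] {f : Fin N → α} {s : ℕ}
    {a : Equiv.Perm (Fin N)} (ha : a ∈ rankings f) {g : Fin s → Fin N}
    (hg : StrictMono (a ∘ g)) : Monotone (f ∘ g) := by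
  simp only [rankings, mem_filter, mem_univ, true_and] at ha
  intro i j hij
  by_contra! h
  exact absurd (ha _ _ h) (not_lt.2 (hg.monotone hij))

/-- Two listings of the same finite set differ by a permutation. -/
theorem exists_perm_comp_eq {s : ℕ} {A : Finset (Fin N)} (hA : #A = s) {g g' : Fin s → Fin N}
    (hg : Function.Injective g) (hgA : ∀ i, g i ∈ A)
    (hg' : Function.Injective g') (hgA' : ∀ i, g' i ∈ A) :
    ∃ τ : Equiv.Perm (Fin s), g' = g ∘ τ := by
  have key : ∀ g : Fin s → Fin N, Function.Injective g → (∀ i, g i ∈ A) →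
      ∃ E : Fin s ≃ A, ∀ i, (E i : Fin N) = g i := by
    intro g hg hgA
    refine ⟨Equiv.ofBijective (fun i => ⟨g i, hgA i⟩) ?_, fun i => rfl⟩
    rw [Fintype.bijective_iff_injective_and_card]
    refine ⟨fun i j h => hg (by simpa using h), by simp [hA]⟩
  obtain ⟨E, hE⟩ := key g hg hgA
  obtain ⟨E', hE'⟩ := key g' hg' hgA'
  refine ⟨E'.trans E.symm, ?_⟩
  ext i
  simp [← hE, ← hE']

theorem card_rankings_filter_le {α : Type*} [LinearOrder α] (f : Fin N → α) {s : ℕ}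
    {A : Finset (Fin N)} (hA : #A = s) {g g' : Fin s → Fin N}
    (hg : g ∈ listings f s A) (hg' : g' ∈ listings f s A) :
    #{a ∈ rankings f | StrictMono ((a : Equiv.Perm (Fin N)) ∘ g)} ≤
      #{a ∈ rankings f | StrictMono ((a : Equiv.Perm (Fin N)) ∘ g')} := by
  simp only [listings, mem_filter, mem_univ, true_and] at hg hg'
  obtain ⟨hg1, hg2, hg3⟩ := hg
  obtain ⟨hg1', hg2', hg3'⟩ := hg'
  obtain ⟨τ, rfl⟩ := exists_perm_comp_eq hA hg1 hg2 hg1' hg2'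
  have hfτ : (f ∘ g) ∘ τ = (f ∘ g) ∘ (1 : Equiv.Perm (Fin s)) :=
    Tuple.unique_monotone hg3' hg3
  set φ : Equiv.Perm (Fin N) := τ.viaFintypeEmbedding ⟨g, hg1⟩ with hφ
  have hφg : ∀ i, φ (g i) = g (τ i) := fun i =>
    Equiv.Perm.viaFintypeEmbedding_apply_image τ ⟨g, hg1⟩ i
  have hfφ : ∀ p, f (φ p) = f p := by
    intro p
    by_cases hp : p ∈ Set.range (⟨g, hg1⟩ : Fin s ↪ Fin N)
    · obtain ⟨i, rfl⟩ := hp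
      have := congrFun hfτ i
      simpa [hφg] using this
    · rw [hφ, Equiv.Perm.viaFintypeEmbedding_apply_notMem_range _ _ hp]
  have hfφ' : ∀ p, f (φ⁻¹ p) = f p := fun p => by
    rw [← hfφ (φ⁻¹ p), Equiv.Perm.coe_inv, Equiv.apply_symm_apply]
  refine card_le_card_of_injOn (fun a => a * φ⁻¹) ?_ (fun a _ b _ h => mul_right_cancel h)
  intro a ha
  simp only [rankings, coe_filter, mem_filter, mem_univ, true_and, Set.mem_ofPred_eq] at ha ⊢
  refine ⟨fun p q hpq => ha.1 _ _ (by rwa [hfφ', hfφ']), ?_⟩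
  convert ha.2 using 1
  ext i
  simp [← hφg]

/-- Every ranking sorts a finite set in exactly one way. -/
theorem card_listings_filter {α : Type*} [LinearOrder α] {f : Fin N → α} {s : ℕ}
    {A : Finset (Fin N)} (hA : #A = s) {a : Equiv.Perm (Fin N)} (ha : a ∈ rankings f) :
    #{g ∈ listings f s A | StrictMono (a ∘ g)} = 1 := by
  have hB : #(A.map a.toEmbedding) = s := by rw [card_map, hA]
  rw [card_eq_one]
  refine ⟨a.symm ∘ (A.map a.toEmbedding).orderEmbOfFin hB, ?_⟩
  ext g
  simp only [mem_filter, mem_singleton]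
  constructor
  · rintro ⟨hg, hag⟩
    simp only [listings, mem_filter, mem_univ, true_and] at hg
    rw [← orderEmbOfFin_unique hB (f := a ∘ g) (by simpa using hg.2.1) hag]
    ext i
    simp
  · rintro rfl
    have h : StrictMono (a ∘ (a.symm ∘ (A.map a.toEmbedding).orderEmbOfFin hB)) := by
      rw [← Function.comp_assoc]
      simpa using (orderEmbOfFin _ hB).strictMono
    refine ⟨?_, h⟩
    simp only [listings, mem_filter, mem_univ, true_and]
    refine ⟨h.injective.of_comp, fun i => ?_, monotone_of_mem_rankings ha h⟩
    have := orderEmbOfFin_mem (A.map a.toEmbedding) hB i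
    rw [mem_map] at this
    obtain ⟨p, hp, hpi⟩ := this
    simp only [Function.comp_apply, ← hpi]
    simpa using hp

/-- A uniform random ranking induces the uniform distribution on listings. -/
theorem card_rankings_filter {α : Type*} [LinearOrder α] (f : Fin N → α) {s : ℕ}
    {A : Finset (Fin N)} (hA : #A = s) {g : Fin s → Fin N} (hg : g ∈ listings f s A) :
    #(listings f s A) * #{a ∈ rankings f | StrictMono ((a : Equiv.Perm (Fin N)) ∘ g)} =
      #(rankings f) := by
  have h1 : ∑ g' ∈ listings f s A, #{a ∈ rankings f | StrictMono ((a : Equiv.Perm (Fin N)) ∘ g')} =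
      #(rankings f) := by
    simp only [card_filter]
    rw [sum_comm]
    simp only [← card_filter]
    rw [sum_congr rfl fun a ha => card_listings_filter hA ha, sum_const, smul_eq_mul, mul_one]
  rw [← h1, sum_congr rfl fun g' hg' => le_antisymm (card_rankings_filter_le f hA hg' hg)
    (card_rankings_filter_le f hA hg hg'), sum_const, smul_eq_mul]

theorem leftOrds_eq_listings (e : Fin N → Fin n × Fin m) (s : ℕ) (A : Finset (Fin N)) :
    leftOrds e s A = listings (fun p => (e p).1) s A := by
  ext g
  simp only [leftOrds, listings, mem_filter, mem_univ, true_and]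
  rfl

theorem mem_rightPerms_iff {e : Fin N → Fin n × Fin m} {s : ℕ} {A : Finset (Fin N)}
    {g : Fin s → Fin N} (hg : Function.Injective g) (hgA : ∀ i, g i ∈ A)
    (σ : Equiv.Perm (Fin s)) :
    σ ∈ rightPerms e s g ↔ g ∘ σ ∈ listings (fun p => (e p).2) s A := by
  simp only [rightPerms, listings, mem_filter, mem_univ, true_and]
  exact ⟨fun h => ⟨hg.comp σ.injective, fun i => hgA _, fun i j => h i j⟩,
    fun h i j => @h.2.2 i j⟩

theorem card_rightPerms {e : Fin N → Fin n × Fin m} {s : ℕ} {A : Finset (Fin N)} (hA : #A = s)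
    {g : Fin s → Fin N} (hg : Function.Injective g) (hgA : ∀ i, g i ∈ A) :
    #(rightPerms e s g) = #(listings (fun p => (e p).2) s A) := by
  refine card_bij (fun σ _ => g ∘ σ) (fun σ h => (mem_rightPerms_iff hg hgA σ).1 h) ?_ ?_
  · intro σ _ τ _ h
    ext i
    exact congrArg _ (hg (congrFun h i))
  · intro g' hg'
    have h := hg'
    simp only [listings, mem_filter, mem_univ, true_and] at h
    obtain ⟨τ, rfl⟩ := exists_perm_comp_eq hA hg hgA h.1 h.2.1
    exact ⟨τ, (mem_rightPerms_iff hg hgA τ).2 hg', rfl⟩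

/-- The number of occurrences of the pattern `σ` in `π`. -/
noncomputable def patternCount {s : ℕ} (π : Equiv.Perm (Fin N)) (σ : Equiv.Perm (Fin s)) : ℕ :=
  #{h : Fin s → Fin N | StrictMono h ∧ StrictMono (π ∘ h ∘ σ)}

theorem card_listings_inv {α : Type*} [LinearOrder α] (f : Fin N → α) {s : ℕ}
    {A : Finset (Fin N)} (hA : #A = s) {g : Fin s → Fin N} (hg : g ∈ listings f s A) :
    (#(listings f s A) : ℝ)⁻¹ =
      (#(rankings f) : ℝ)⁻¹ * ∑ a ∈ rankings f, if StrictMono (a ∘ g) then 1 else 0 := by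
  have h := card_rankings_filter f hA hg
  have h0 : (#(rankings f) : ℝ) ≠ 0 := by
    exact_mod_cast (card_pos.2 (rankings_nonempty f)).ne'
  have h1 : (#(listings f s A) : ℝ) ≠ 0 := by
    exact_mod_cast (card_pos.2 ⟨g, hg⟩).ne'
  rw [sum_boole]
  field_simp
  exact_mod_cast h.symm

theorem sum_listings_eq_patternCount {α : Type*} [LinearOrder α] {f : Fin N → α} {s : ℕ}
    {a : Equiv.Perm (Fin N)} (ha : a ∈ rankings f) (b : Equiv.Perm (Fin N))
    (σ : Equiv.Perm (Fin s)) :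
    ∑ A ∈ powersetCard s (univ : Finset (Fin N)), ∑ g ∈ listings f s A,
      (if StrictMono (a ∘ g) then (1 : ℝ) else 0) *
        (if StrictMono (b ∘ g ∘ σ) then 1 else 0) = patternCount (b * a⁻¹) σ := by
  rw [sum_comm' (s' := fun g => {A ∈ powersetCard s univ | g ∈ listings f s A}) (t' := univ)
    (by simp)]
  have h1 : ∀ g : Fin s → Fin N,
      ∑ A ∈ powersetCard s univ with g ∈ listings f s A,
        (if StrictMono (a ∘ g) then (1 : ℝ) else 0) *
          (if StrictMono (b ∘ g ∘ σ) then 1 else 0) =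
      if StrictMono (a ∘ g) ∧ StrictMono (b ∘ g ∘ σ) then 1 else 0 := by
    intro g
    by_cases hg : StrictMono (a ∘ g)
    · have hgi : Function.Injective g := hg.injective.of_comp
      have : ({A ∈ powersetCard s univ | g ∈ listings f s A} : Finset (Finset (Fin N))) =
          {univ.image g} := by
        ext A
        simp only [mem_filter, mem_powersetCard, subset_univ, true_and, listings, mem_univ,
          mem_singleton]
        constructor
        · rintro ⟨hA, -, hgA, -⟩
          refine (eq_of_subset_of_card_le ?_ ?_).symm
          · simpa [image_subset_iff] using hgA
          · rw [card_image_of_injective _ hgi, hA, card_univ, Fintype.card_fin]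
        · rintro rfl
          exact ⟨by rw [card_image_of_injective _ hgi, card_univ, Fintype.card_fin], hgi,
            fun i => mem_image_of_mem _ (mem_univ _), monotone_of_mem_rankings ha hg⟩
      rw [this]
      simp [hg]
    · simp [hg]
  rw [sum_congr rfl fun g _ => h1 g, sum_boole, patternCount]
  congr 1
  refine card_bij (fun g _ => a ∘ g) ?_ ?_ ?_
  · intro g hg
    simp only [mem_filter, mem_univ, true_and] at hg ⊢
    refine ⟨hg.1, ?_⟩
    convert hg.2 using 1
    ext i
    simp
  · intro g _ g' _ h
    exact a.injective.comp_left h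
  · intro h hh
    simp only [mem_filter, mem_univ, true_and] at hh
    refine ⟨a.symm ∘ h, ?_, by ext; simp⟩
    simp only [mem_filter, mem_univ, true_and]
    refine ⟨?_, hh.2⟩
    convert hh.1 using 1
    ext i
    simp

theorem inducedProb_eq_sum_rankings (e : Fin N → Fin n × Fin m) (s : ℕ)
    (σ : Equiv.Perm (Fin s)) :
    inducedProb e s σ =
      ∑ a ∈ rankings fun p => (e p).1, ∑ b ∈ rankings fun p => (e p).2,
        (#(rankings fun p => (e p).1) : ℝ)⁻¹ * (#(rankings fun p => (e p).2) : ℝ)⁻¹ *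
          ((patternCount (b * a⁻¹) σ : ℝ) / N.choose s) := by
  set R₁ := rankings fun p => (e p).1 with hR₁
  set R₂ := rankings fun p => (e p).2 with hR₂
  have h1 : ∀ A ∈ powersetCard s (univ : Finset (Fin N)),
      ((leftOrds e s A).card : ℝ)⁻¹ * ∑ g ∈ leftOrds e s A,
          ((rightPerms e s g).card : ℝ)⁻¹ * (if σ ∈ rightPerms e s g then (1 : ℝ) else 0) =
      ∑ g ∈ listings (fun p => (e p).1) s A, ∑ a ∈ R₁, ∑ b ∈ R₂,
        (#R₁ : ℝ)⁻¹ * (#R₂ : ℝ)⁻¹ * ((if StrictMono (a ∘ g) then (1 : ℝ) else 0) *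
        (if StrictMono (b ∘ g ∘ σ) then 1 else 0)) := by
    intro A hA
    rw [mem_powersetCard] at hA
    rw [leftOrds_eq_listings, mul_sum]
    refine sum_congr rfl fun g hg => ?_
    have hg' := hg
    simp only [listings, mem_filter, mem_univ, true_and] at hg'
    have h2 : ((rightPerms e s g).card : ℝ)⁻¹ *
        (if σ ∈ rightPerms e s g then (1 : ℝ) else 0) =
        (#R₂ : ℝ)⁻¹ * ∑ b ∈ R₂, if StrictMono (b ∘ g ∘ σ) then 1 else 0 := by
      rw [card_rightPerms hA.2 hg'.1 hg'.2.1]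
      split_ifs with hσ
      · rw [mem_rightPerms_iff hg'.1 hg'.2.1] at hσ
        rw [mul_one, card_listings_inv _ hA.2 hσ]
      · rw [mul_zero, eq_comm]
        refine mul_eq_zero_of_right _ (sum_eq_zero fun b hb => if_neg fun h => hσ ?_)
        rw [mem_rightPerms_iff hg'.1 hg'.2.1]
        simp only [listings, mem_filter, mem_univ, true_and]
        exact ⟨hg'.1.comp σ.injective, fun i => hg'.2.1 _, monotone_of_mem_rankings hb h⟩
    rw [h2, card_listings_inv _ hA.2 hg, ← hR₁, mul_mul_mul_comm, sum_mul_sum, mul_sum]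
    exact sum_congr rfl fun a _ => mul_sum _ _ _
  rw [inducedProb, sum_congr rfl h1]
  rw [sum_congr rfl fun A _ => sum_comm, sum_comm, mul_sum]
  refine sum_congr rfl fun a ha => ?_
  rw [sum_congr rfl fun A _ => sum_comm, sum_comm, mul_sum]
  refine sum_congr rfl fun b _ => ?_
  rw [← sum_listings_eq_patternCount ha b σ]
  simp only [← mul_sum]
  ring

/-- The induced permutations of a bipartite multigraph are those of a random permutation. -/
theorem exists_weights_inducedProb (e : Fin N → Fin n × Fin m) :
    ∃ w : Equiv.Perm (Fin N) → ℝ, (∀ π, 0 ≤ w π) ∧ ∑ π, w π = 1 ∧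
      ∀ (s : ℕ) (σ : Equiv.Perm (Fin s)),
        inducedProb e s σ = ∑ π, w π * ((patternCount π σ : ℝ) / N.choose s) := by
  set R₁ := rankings fun p => (e p).1 with hR₁
  set R₂ := rankings fun p => (e p).2 with hR₂
  have key : ∀ F : Equiv.Perm (Fin N) → ℝ,
      ∑ π, (∑ a ∈ R₁, ∑ b ∈ R₂, if b * a⁻¹ = π then (#R₁ : ℝ)⁻¹ * (#R₂ : ℝ)⁻¹ else 0) * F π =
      ∑ a ∈ R₁, ∑ b ∈ R₂, (#R₁ : ℝ)⁻¹ * (#R₂ : ℝ)⁻¹ * F (b * a⁻¹) := by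
    intro F
    simp only [sum_mul]
    rw [sum_comm]
    refine sum_congr rfl fun a _ => ?_
    rw [sum_comm]
    refine sum_congr rfl fun b _ => ?_
    simp [ite_mul]
  refine ⟨fun π => ∑ a ∈ R₁, ∑ b ∈ R₂,
    if b * a⁻¹ = π then (#R₁ : ℝ)⁻¹ * (#R₂ : ℝ)⁻¹ else 0, fun π => ?_, ?_, fun s σ => ?_⟩
  · exact sum_nonneg fun a _ => sum_nonneg fun b _ => by split_ifs <;> positivity
  · have := key fun _ => 1
    simp only [mul_one] at this
    rw [this]
    have h1 : (#R₁ : ℝ) ≠ 0 := by exact_mod_cast (card_pos.2 (rankings_nonempty _)).ne'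
    have h2 : (#R₂ : ℝ) ≠ 0 := by exact_mod_cast (card_pos.2 (rankings_nonempty _)).ne'
    simp only [sum_const, nsmul_eq_mul]
    field_simp
  · rw [inducedProb_eq_sum_rankings, key]

end

section

open scoped Classical

/-- The number of points of the graph of `π` in the corner `[0, i) × [0, j)`. -/
noncomputable def cornerCount (π : Equiv.Perm (Fin N)) (i j : ℕ) : ℕ :=
  #{q : Fin N | (q : ℕ) < i ∧ (π q : ℕ) < j}

/-- The scaled deviation of `cornerCount` from its expected value. -/
noncomputable def cornerDisc (π : Equiv.Perm (Fin N)) (i j : ℕ) : ℝ :=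
  N * cornerCount π i j - i * j

theorem cornerDisc_inv (π : Equiv.Perm (Fin N)) (i j : ℕ) :
    cornerDisc π⁻¹ i j = cornerDisc π j i := by
  have : cornerCount π⁻¹ i j = cornerCount π j i := by
    refine card_bij (fun q _ => π⁻¹ q) ?_ (fun _ _ _ _ h => π⁻¹.injective h)
      fun q hq => ⟨π q, ?_, by simp⟩
    · intro q hq
      simpa [and_comm] using hq
    · simpa [and_comm] using hq
  rw [cornerDisc, cornerDisc, this, mul_comm (i : ℝ)]

theorem cornerDisc_top (π : Equiv.Perm (Fin N)) {j : ℕ} (hj : j ≤ N) :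
    cornerDisc π N j = 0 := by
  have : cornerCount π N j = j := by
    have h : #{q : Fin N | (q : ℕ) < j} = j := by
      rw [Fin.card_filter_val_lt, min_eq_right hj]
    rw [cornerCount, ← h]
    refine card_bij (fun q _ => π q) ?_ (fun _ _ _ _ h => π.injective h)
      fun q hq => ⟨π⁻¹ q, ?_, by simp⟩
    · intro q hq
      simpa [h] using hq
    · simpa [h] using hq
  rw [cornerDisc, this, sub_self]

theorem abs_cornerDisc_succ_sub_le (π : Equiv.Perm (Fin N)) (i : ℕ) {j : ℕ} (hj : j ≤ N) :
    |cornerDisc π (i + 1) j - cornerDisc π i j| ≤ N := by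
  have h1 : cornerCount π i j ≤ cornerCount π (i + 1) j :=
    card_le_card fun q hq => by
      simp only [mem_filter, mem_univ, true_and] at hq ⊢
      omega
  have h2 : cornerCount π (i + 1) j ≤ cornerCount π i j + 1 := by
    have h3 : #{q : Fin N | (q : ℕ) = i} ≤ 1 := by
      rw [card_le_one]
      intro p hp q hq
      simp only [mem_filter, mem_univ, true_and] at hp hq
      exact Fin.ext (hp.trans hq.symm)
    refine (card_le_card (t := ({q : Fin N | (q : ℕ) < i ∧ (π q : ℕ) < j} : Finset (Fin N)) ∪
      ({q : Fin N | (q : ℕ) = i} : Finset (Fin N))) fun q hq => ?_).trans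
      ((card_union_le _ _).trans (Nat.add_le_add_left h3 _))
    simp only [mem_union, mem_filter, mem_univ, true_and] at hq ⊢
    omega
  have h1' : (cornerCount π i j : ℝ) ≤ cornerCount π (i + 1) j := by exact_mod_cast h1
  have h2' : (cornerCount π (i + 1) j : ℝ) ≤ cornerCount π i j + 1 := by exact_mod_cast h2
  have hj' : (j : ℝ) ≤ N := by exact_mod_cast hj
  have hN : (0 : ℝ) ≤ N := by positivity
  have hj0 : (0 : ℝ) ≤ j := by positivity
  rw [cornerDisc, cornerDisc, abs_le]
  push_cast
  constructor <;> nlinarith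

theorem abs_cornerDisc_add_sub_le (π : Equiv.Perm (Fin N)) (i d : ℕ) {j : ℕ} (hj : j ≤ N) :
    |cornerDisc π (i + d) j - cornerDisc π i j| ≤ N * d := by
  induction d with
  | zero => simp
  | succ d ih =>
    have := abs_cornerDisc_succ_sub_le π (i + d) hj
    rw [← add_assoc]
    push_cast
    calc _ ≤ _ := abs_sub_le _ (cornerDisc π (i + d) j) _
      _ ≤ _ := by linarith

theorem abs_cornerDisc_add_add_sub_le (π : Equiv.Perm (Fin N)) {i j d c : ℕ}
    (hi : i ≤ N) (hj : j + c ≤ N) :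
    |cornerDisc π (i + d) (j + c) - cornerDisc π i j| ≤ N * (d + c) := by
  have h1 := abs_cornerDisc_add_sub_le π i d hj
  have h2 := abs_cornerDisc_add_sub_le π⁻¹ j c hi
  rw [cornerDisc_inv, cornerDisc_inv] at h2
  calc _ ≤ _ := abs_sub_le _ (cornerDisc π i (j + c)) _
    _ ≤ _ := by linarith

theorem abs_cornerDisc_le (π : Equiv.Perm (Fin N)) {i j : ℕ} (hi : i ≤ N) (hj : j ≤ N) :
    |cornerDisc π i j| ≤ N * (N - i) := by
  have h := abs_cornerDisc_add_sub_le π i (N - i) hj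
  rw [Nat.add_sub_cancel' hi, cornerDisc_top π hj, zero_sub, abs_neg] at h
  rwa [Nat.cast_sub hi] at h

/-- A large corner deviation forces a large mean square deviation. -/
theorem pow_abs_cornerDisc_le (π : Equiv.Perm (Fin N)) {i j : ℕ} (hi : i ≤ N) (hj : j ≤ N) :
    |cornerDisc π i j| ^ 4 ≤ 64 * (N : ℝ) ^ 2 * ∑ a : Fin N, ∑ b : Fin N, cornerDisc π a b ^ 2 := by
  set M := |cornerDisc π i j| with hM
  have hM0 : 0 ≤ M := abs_nonneg _
  rcases hM0.eq_or_lt with h0 | h0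
  · rw [← h0, zero_pow four_ne_zero]
    positivity
  have hiM : M ≤ N * (N - i) := abs_cornerDisc_le π hi hj
  have hjM : M ≤ N * (N - j) := by
    have := abs_cornerDisc_le π⁻¹ hj hi
    rwa [cornerDisc_inv] at this
  have hN : (0 : ℝ) < N := by
    rcases Nat.eq_zero_or_pos N with h | h
    · subst h
      simp only [CharP.cast_eq_zero, zero_mul] at hiM
      linarith
    · exact_mod_cast h
  set x : ℝ := M / (4 * N) with hx
  have hx0 : 0 < x := by positivity
  have hxM : M = 4 * N * x := by rw [hx]; field_simp
  have hix : 4 * x ≤ N - i := by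
    rw [hxM] at hiM
    exact le_of_mul_le_mul_left (by linarith) hN
  have hjx : 4 * x ≤ N - j := by
    rw [hxM] at hjM
    exact le_of_mul_le_mul_left (by linarith) hN
  set t := ⌊x⌋₊ with ht
  have htx : (t : ℝ) ≤ x := Nat.floor_le hx0.le
  have htx' : x ≤ (t + 1 : ℕ) := by
    push_cast
    exact (Nat.lt_floor_add_one x).le
  have hit : i + t < N := by
    have : (i + t : ℝ) < N := by linarith
    exact_mod_cast this
  have hjt : j + t < N := by
    have : (j + t : ℝ) < N := by linarith
    exact_mod_cast this
  have hlow : ∀ d ∈ range (t + 1), ∀ c ∈ range (t + 1),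
      (M / 2) ^ 2 ≤ cornerDisc π (i + d) (j + c) ^ 2 := by
    intro d hd c hc
    rw [mem_range] at hd hc
    have h1 := abs_cornerDisc_add_add_sub_le π (d := d) hi (show j + c ≤ N by omega)
    have hd' : (d : ℝ) ≤ x := le_trans (by exact_mod_cast Nat.lt_succ_iff.1 hd) htx
    have hc' : (c : ℝ) ≤ x := le_trans (by exact_mod_cast Nat.lt_succ_iff.1 hc) htx
    have h2 : (N : ℝ) * (d + c) ≤ M / 2 := by
      rw [hxM]
      nlinarith
    have h3 : M / 2 ≤ |cornerDisc π (i + d) (j + c)| := by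
      have := abs_sub_abs_le_abs_sub (cornerDisc π i j) (cornerDisc π (i + d) (j + c))
      rw [abs_sub_comm] at this
      linarith
    rw [← sq_abs (cornerDisc π (i + d) (j + c))]
    gcongr
  have hsum : ((t + 1 : ℕ) : ℝ) * ((t + 1 : ℕ) * (M / 2) ^ 2) ≤
      ∑ a : Fin N, ∑ b : Fin N, cornerDisc π a b ^ 2 := by
    calc ((t + 1 : ℕ) : ℝ) * ((t + 1 : ℕ) * (M / 2) ^ 2)
        = ∑ d ∈ range (t + 1), ∑ c ∈ range (t + 1), (M / 2) ^ 2 := by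
          simp only [sum_const, card_range, nsmul_eq_mul]
      _ ≤ ∑ d ∈ range (t + 1), ∑ c ∈ range (t + 1), cornerDisc π (i + d) (j + c) ^ 2 :=
          sum_le_sum fun d hd => sum_le_sum fun c hc => hlow d hd c hc
      _ = ∑ a ∈ Ico i (i + (t + 1)), ∑ b ∈ Ico j (j + (t + 1)), cornerDisc π a b ^ 2 := by
          simp only [sum_Ico_eq_sum_range, Nat.add_sub_cancel_left]
      _ ≤ ∑ a ∈ range N, ∑ b ∈ range N, cornerDisc π a b ^ 2 := by
          refine (sum_le_sum fun a _ => sum_le_sum_of_subset_of_nonneg ?_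
            fun _ _ _ => sq_nonneg _).trans
            (sum_le_sum_of_subset_of_nonneg ?_ fun _ _ _ => sum_nonneg fun _ _ => sq_nonneg _)
          · intro b hb
            simp only [mem_Ico, mem_range] at hb ⊢
            omega
          · intro b hb
            simp only [mem_Ico, mem_range] at hb ⊢
            omega
      _ = _ := by
          rw [Finset.sum_range]
          exact sum_congr rfl fun a _ => Finset.sum_range _
  calc M ^ 4 = 64 * (N : ℝ) ^ 2 * (x * (x * (M / 2) ^ 2)) := by
        rw [hxM]
        ring
    _ ≤ 64 * (N : ℝ) ^ 2 * (((t + 1 : ℕ) : ℝ) * ((t + 1 : ℕ) * (M / 2) ^ 2)) := by gcongr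
    _ ≤ _ := by gcongr

theorem exists_cornerDisc_bound (π : Equiv.Perm (Fin N)) :
    ∃ M : ℝ, 0 ≤ M ∧ (∀ i ≤ N, ∀ j ≤ N, |cornerDisc π i j| ≤ M) ∧
      M ^ 4 ≤ 64 * (N : ℝ) ^ 2 * ∑ a : Fin N, ∑ b : Fin N, cornerDisc π a b ^ 2 := by
  obtain ⟨x, hx, hmax⟩ := exists_max_image (range (N + 1) ×ˢ range (N + 1))
    (fun x => |cornerDisc π x.1 x.2|) ⟨(0, 0), by simp⟩
  simp only [mem_product, mem_range, Nat.lt_succ_iff] at hx hmax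
  exact ⟨_, abs_nonneg _, fun i hi j hj => hmax (i, j) ⟨hi, hj⟩,
    pow_abs_cornerDisc_le π hx.1 hx.2⟩

/-- The indicator of an order-connected predicate is a difference of indicators of initial
segments. -/
theorem exists_indicator_eq_sub {A : Fin N → Prop}
    (hA : ∀ u v w, u ≤ v → v ≤ w → A u → A w → A v) :
    ∃ a ≤ N, ∃ b ≤ N, ∀ v : Fin N, (if A v then (1 : ℝ) else 0) =
      (if (v : ℕ) < b then 1 else 0) - (if (v : ℕ) < a then 1 else 0) := by
  by_cases hne : ({v | A v} : Finset (Fin N)).Nonempty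
  · refine ⟨(min' _ hne : Fin N), (min' _ hne).2.le, (max' _ hne : Fin N) + 1, (max' _ hne).2,
      fun v => ?_⟩
    have h1 := min'_mem _ hne
    have h2 := max'_mem _ hne
    have h3 := min'_le ({v | A v} : Finset (Fin N)) v
    have h4 := le_max' ({v | A v} : Finset (Fin N)) v
    have h5 := min'_le_max' _ hne
    set x := min' _ hne
    set y := max' _ hne
    simp only [mem_filter, mem_univ, true_and] at h1 h2 h3 h4
    by_cases hv : A v
    · have h3' : (x : ℕ) ≤ v := h3 hv
      have h4' : (v : ℕ) ≤ y := h4 hv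
      rw [if_pos hv, if_pos (by omega), if_neg (by omega), sub_zero]
    · have h6 : ¬ ((x : ℕ) ≤ v ∧ (v : ℕ) ≤ y) := fun h => hv (hA x v y h.1 h.2 h1 h2)
      have h5' : (x : ℕ) ≤ y := h5
      rw [if_neg hv]
      by_cases h7 : (v : ℕ) < x
      · rw [if_pos (by omega), if_pos h7, sub_self]
      · rw [if_neg (by omega), if_neg h7, sub_self]
  · refine ⟨0, Nat.zero_le _, 0, Nat.zero_le _, fun v => ?_⟩
    rw [if_neg fun h => hne ⟨v, by simpa using h⟩, sub_self]

theorem abs_rectangle_disc_le (π : Equiv.Perm (Fin N)) {M : ℝ}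
    (hM : ∀ i ≤ N, ∀ j ≤ N, |cornerDisc π i j| ≤ M) {A B : Fin N → Prop}
    (hA : ∀ u v w, u ≤ v → v ≤ w → A u → A w → A v)
    (hB : ∀ u v w, u ≤ v → v ≤ w → B u → B w → B v) :
    |(N : ℝ) * ∑ v, (if A v then (1 : ℝ) else 0) * (if B (π v) then 1 else 0) -
      (∑ v, if A v then (1 : ℝ) else 0) * ∑ w, if B w then (1 : ℝ) else 0| ≤ 4 * M := by
  obtain ⟨a, ha, b, hb, hab⟩ := exists_indicator_eq_sub hA
  obtain ⟨c, hc, d, hd, hcd⟩ := exists_indicator_eq_sub hB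
  have h1 : ∀ i ≤ N, ∑ v : Fin N, (if (v : ℕ) < i then (1 : ℝ) else 0) = i := by
    intro i hi
    rw [sum_boole, Fin.card_filter_val_lt, min_eq_right hi]
  have h2 : ∀ i j, ∑ v : Fin N, (if (v : ℕ) < i then (1 : ℝ) else 0) *
      (if (π v : ℕ) < j then 1 else 0) = cornerCount π i j := by
    intro i j
    rw [cornerCount, ← sum_boole]
    refine sum_congr rfl fun v _ => ?_
    rw [ite_and, ite_mul, one_mul, zero_mul]
  simp only [hab, hcd, sub_mul, mul_sub, sum_sub_distrib, h1 _ ha, h1 _ hb, h1 _ hc, h1 _ hd, h2]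
  have e1 := abs_le.1 (hM b hb d hd)
  have e2 := abs_le.1 (hM a ha d hd)
  have e3 := abs_le.1 (hM b hb c hc)
  have e4 := abs_le.1 (hM a ha c hc)
  simp only [cornerDisc] at e1 e2 e3 e4
  rw [abs_le]
  constructor <;> linarith [e1.1, e1.2, e2.1, e2.2, e3.1, e3.2, e4.1, e4.2]

end

section

open scoped Classical

/-- Resampling one coordinate preserves the uniform distribution. -/
theorem sum_sum_update {ι α : Type*} [Fintype ι] [DecidableEq ι] [Fintype α] (i : ι)
    (F : (ι → α) → ℝ) :
    ∑ x : ι → α, ∑ v, F (Function.update x i v) = Fintype.card α * ∑ x, F x := by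
  rw [← Fintype.sum_prod_type']
  have hinv : Function.Involutive fun p : (ι → α) × α => (Function.update p.1 i p.2, p.1 i) := by
    rintro ⟨x, v⟩
    simp
  rw [Fintype.sum_equiv (Equiv.ofBijective _ hinv.bijective)
    (fun p : (ι → α) × α => F (Function.update p.1 i p.2)) (fun p => F p.1) fun p => rfl]
  rw [Fintype.sum_prod_type]
  simp [mul_sum]

theorem strictMono_update_between {s : ℕ} (σ : Equiv.Perm (Fin s)) (y : Fin s → Fin N) (i : Fin s)
    (u v w : Fin N) (huv : u ≤ v) (hvw : v ≤ w) (hu : StrictMono (Function.update y i u ∘ σ))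
    (hw : StrictMono (Function.update y i w ∘ σ)) : StrictMono (Function.update y i v ∘ σ) := by
  intro j k hjk
  have h1 := hu hjk
  have h2 := hw hjk
  simp only [Function.comp_apply, Function.update_apply] at h1 h2 ⊢
  split_ifs at h1 h2 ⊢
  · exact absurd h1 (lt_irrefl _)
  · exact hvw.trans_lt h2
  · exact h1.trans_le huv
  · exact h1

/-- The number of pairs of an increasing `x` and a `σ`-increasing sequence that follows
`π ∘ x` on `T` and is free elsewhere. -/
noncomputable def hybridSum {s : ℕ} (π : Equiv.Perm (Fin N)) (σ : Equiv.Perm (Fin s))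
    (T : Finset (Fin s)) : ℝ :=
  ∑ x : Fin s → Fin N, ∑ z : Fin s → Fin N,
    (if StrictMono x then 1 else 0) *
      (if StrictMono (T.piecewise (π ∘ x) z ∘ σ) then 1 else 0)

theorem sq_mul_sum_sum {s : ℕ} (i : Fin s) (G : (Fin s → Fin N) → (Fin s → Fin N) → ℝ) :
    (N : ℝ) ^ 2 * ∑ x, ∑ z, G x z =
      ∑ x, ∑ z, ∑ v, ∑ w, G (Function.update x i v) (Function.update z i w) := by
  have h1 : ∀ x : Fin s → Fin N, ∑ z, ∑ v, ∑ w, G (Function.update x i v) (Function.update z i w) =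
      N * ∑ v, ∑ z, G (Function.update x i v) z := by
    intro x
    rw [sum_comm, mul_sum]
    refine sum_congr rfl fun v _ => ?_
    rw [sum_sum_update i fun z => G (Function.update x i v) z, Fintype.card_fin]
  rw [sum_congr rfl fun x _ => h1 x, ← mul_sum, sum_sum_update i fun x => ∑ z, G x z,
    Fintype.card_fin]
  ring

theorem abs_hybridSum_insert_sub_le {s : ℕ} (π : Equiv.Perm (Fin N)) (σ : Equiv.Perm (Fin s))
    {M : ℝ} (hM : ∀ i ≤ N, ∀ j ≤ N, |cornerDisc π i j| ≤ M) {T : Finset (Fin s)} {i : Fin s}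
    (hi : i ∉ T) :
    (N : ℝ) ^ 2 * |hybridSum π σ (insert i T) - hybridSum π σ T| ≤
      (N : ℝ) ^ (2 * s) * (4 * M) := by
  have hN2 : (0 : ℝ) ≤ (N : ℝ) ^ 2 := by positivity
  have habs : ∀ X : ℝ, (N : ℝ) ^ 2 * |X| = |(N : ℝ) ^ 2 * X| := fun X => by
    rw [abs_mul, abs_of_nonneg hN2]
  rw [habs, mul_sub, hybridSum, hybridSum, sq_mul_sum_sum i, sq_mul_sum_sum i]
  have h1 : ∀ (x z : Fin s → Fin N) (v w : Fin N),
      (insert i T).piecewise (π ∘ Function.update x i v) (Function.update z i w) =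
        Function.update (T.piecewise (π ∘ x) z) i (π v) := by
    intro x z v w
    ext k
    by_cases hk : k = i
    · subst hk
      simp
    · by_cases hkT : k ∈ T <;> simp [hk, hkT, Finset.piecewise]
  have h2 : ∀ (x z : Fin s → Fin N) (v w : Fin N),
      T.piecewise (π ∘ Function.update x i v) (Function.update z i w) =
        Function.update (T.piecewise (π ∘ x) z) i w := by
    intro x z v w
    ext k
    by_cases hk : k = i
    · subst hk
      simp [hi]
    · by_cases hkT : k ∈ T <;> simp [hk, hkT, Finset.piecewise]
  simp only [h1, h2, ← sum_sub_distrib]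
  have h3 : ∀ x z : Fin s → Fin N, |∑ v, ((∑ w : Fin N,
      (if StrictMono (Function.update x i v) then (1 : ℝ) else 0) *
        (if StrictMono (Function.update (T.piecewise (π ∘ x) z) i (π v) ∘ σ) then 1 else 0)) -
      ∑ w, (if StrictMono (Function.update x i v) then (1 : ℝ) else 0) *
        (if StrictMono (Function.update (T.piecewise (π ∘ x) z) i w ∘ σ) then 1 else 0))| ≤
      4 * M := by
    intro x z
    have h := abs_rectangle_disc_le π hM
      (strictMono_update_between (1 : Equiv.Perm (Fin s)) x i)
      (strictMono_update_between σ (T.piecewise (π ∘ x) z) i)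
    simp only [Equiv.Perm.coe_one, Function.comp_id] at h
    convert h using 2
    rw [sum_sub_distrib, sum_mul_sum, mul_sum]
    congr 1
    · exact sum_congr rfl fun v _ => by
        rw [sum_const, card_univ, Fintype.card_fin, nsmul_eq_mul]
        congr
    · exact sum_congr rfl fun v _ => sum_congr rfl fun w _ => by congr
  simp only [sum_sub_distrib] at h3 ⊢
  simp only [← sum_sub_distrib]
  simp only [← sum_sub_distrib] at h3
  refine (abs_sum_le_sum_abs _ _).trans ((sum_le_sum fun x _ =>
    (abs_sum_le_sum_abs _ _).trans (sum_le_sum fun z _ => h3 x z)).trans ?_)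
  simp only [sum_const, card_univ, Fintype.card_fun, Fintype.card_fin, nsmul_eq_mul]
  push_cast
  rw [two_mul, pow_add, mul_assoc]

theorem abs_hybridSum_sub_le {s : ℕ} (π : Equiv.Perm (Fin N)) (σ : Equiv.Perm (Fin s))
    {M : ℝ} (hM : ∀ i ≤ N, ∀ j ≤ N, |cornerDisc π i j| ≤ M) (T : Finset (Fin s)) :
    (N : ℝ) ^ 2 * |hybridSum π σ T - hybridSum π σ ∅| ≤ #T * ((N : ℝ) ^ (2 * s) * (4 * M)) := by
  induction T using Finset.induction_on with
  | empty => simp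
  | insert i T hi ih =>
    rw [card_insert_of_notMem hi]
    have h1 := abs_hybridSum_insert_sub_le π σ hM hi
    have h2 := abs_sub_le (hybridSum π σ (insert i T)) (hybridSum π σ T) (hybridSum π σ ∅)
    have h3 := mul_le_mul_of_nonneg_left h2 (show (0 : ℝ) ≤ (N : ℝ) ^ 2 by positivity)
    push_cast
    linarith

theorem sum_strictMono_comp (u : Fin N → Fin m) :
    ∑ τ : Equiv.Perm (Fin N), (if StrictMono (u ∘ τ) then (1 : ℝ) else 0) =
      if Function.Injective u then 1 else 0 := by
  split_ifs with hu
  · rw [sum_eq_single (Tuple.sort u), if_pos]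
    · exact (Tuple.monotone_sort u).strictMono_of_injective (hu.comp (Tuple.sort u).injective)
    · intro τ _ hτ
      refine if_neg fun h => hτ ?_
      have := Tuple.unique_monotone h.monotone (Tuple.monotone_sort u)
      ext i
      exact congrArg _ (hu (congrFun this i))
    · simp
  · exact sum_eq_zero fun τ _ => if_neg fun h =>
      hu ((Equiv.injective_comp τ u).1 h.injective)

theorem sum_injective_eq {s : ℕ} (Φ : (Fin s → Fin N) → ℝ) :
    ∑ g : Fin s → Fin N, (if Function.Injective g then 1 else 0) * Φ g =
      ∑ τ : Equiv.Perm (Fin s), ∑ h : Fin s → Fin N,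
        (if StrictMono h then 1 else 0) * Φ (h ∘ τ) := by
  simp only [← sum_strictMono_comp, sum_mul]
  rw [sum_comm]
  rw [← Equiv.sum_comp (Equiv.inv (Equiv.Perm (Fin s)))]
  refine sum_congr rfl fun τ _ => ?_
  rw [← Equiv.sum_comp (Equiv.arrowCongr τ.symm (Equiv.refl (Fin N)))]
  refine sum_congr rfl fun g _ => ?_
  have : Equiv.arrowCongr τ.symm (Equiv.refl (Fin N)) g = g ∘ τ := rfl
  have hg : (g ∘ τ) ∘ Equiv.inv (Equiv.Perm (Fin s)) τ = g := by
    ext i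
    simp
  rw [this, hg]

theorem sum_injective (s : ℕ) :
    ∑ g : Fin s → Fin N, (if Function.Injective g then (1 : ℝ) else 0) =
      s.factorial * N.choose s := by
  have h : Fintype.card (Fin s ↪ Fin N) = N.descFactorial s := by
    simp [Fintype.card_embedding_eq]
  rw [sum_boole, ← Nat.cast_mul, ← Nat.descFactorial_eq_factorial_mul_choose, ← h,
    ← Fintype.card_subtype]
  exact congrArg _ (Fintype.card_congr (Equiv.subtypeInjectiveEquivEmbedding _ _))

theorem sum_strictMono (s : ℕ) :
    ∑ h : Fin s → Fin N, (if StrictMono h then (1 : ℝ) else 0) = N.choose s := by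
  have h := sum_injective_eq (N := N) (s := s) fun _ => 1
  simp only [mul_one] at h
  rw [sum_injective, sum_const, card_univ, Fintype.card_perm, Fintype.card_fin,
    nsmul_eq_mul] at h
  exact (mul_left_cancel₀ (by positivity) h).symm

theorem patternCount_eq_sum {s : ℕ} (π : Equiv.Perm (Fin N)) (σ : Equiv.Perm (Fin s)) :
    (patternCount π σ : ℝ) = ∑ h : Fin s → Fin N,
      (if StrictMono h then 1 else 0) * (if StrictMono (π ∘ h ∘ σ) then 1 else 0) := by
  rw [patternCount, ← sum_boole]
  refine sum_congr rfl fun h _ => ?_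
  rw [ite_and, ite_mul, one_mul, zero_mul]

/-- Small corner deviations force every pattern to have roughly its expected count. -/
theorem abs_patternCount_sub_le {s : ℕ} (π : Equiv.Perm (Fin N)) (σ : Equiv.Perm (Fin s))
    {M : ℝ} (hM : ∀ i ≤ N, ∀ j ≤ N, |cornerDisc π i j| ≤ M) :
    (N : ℝ) ^ 2 * |(N : ℝ) ^ s * patternCount π σ - (N.choose s : ℝ) ^ 2| ≤
      s * ((N : ℝ) ^ (2 * s) * (4 * M)) := by
  have h := abs_hybridSum_sub_le π σ hM univ
  rw [card_univ, Fintype.card_fin] at h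
  convert h using 4
  · rw [hybridSum, patternCount_eq_sum]
    simp [mul_sum, Function.comp_assoc]
  · rw [hybridSum]
    simp only [piecewise_empty]
    rw [← sum_mul_sum, sum_strictMono, sq]
    congr 1
    rw [← sum_strictMono]
    rw [← Equiv.sum_comp (Equiv.arrowCongr σ.symm (Equiv.refl (Fin N)))]
    refine sum_congr rfl fun g _ => ?_
    have : Equiv.arrowCongr σ.symm (Equiv.refl (Fin N)) g = g ∘ σ := rfl
    rw [this]

end

section

open scoped Classical

theorem sum_fin_four {α : Type*} [Fintype α] (f : (Fin 4 → α) → ℝ) :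
    ∑ g, f g = ∑ c, ∑ d, ∑ a, ∑ b, f ![a, b, c, d] := by
  let E : α × α × α × α ≃ (Fin 4 → α) :=
    { toFun := fun p => ![p.2.2.1, p.2.2.2, p.1, p.2.1]
      invFun := fun g => (g 2, g 3, g 0, g 1)
      left_inv := fun p => rfl
      right_inv := fun g => by
        ext i
        fin_cases i <;> rfl }
  rw [← E.sum_comp]
  simp only [Fintype.sum_prod_type]
  rfl

/-- The number of quadruples of points of the graph of `π` whose first two entries lie to the left
of the third, and whose entries `a` and `b` lie below the entry `c`. -/
noncomputable def cornerQuadruples (π : Equiv.Perm (Fin N)) (a b c : Fin 4) : ℕ :=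
  #{g : Fin 4 → Fin N | (g 0 < g 2 ∧ g 1 < g 2) ∧ π (g a) < π (g c) ∧ π (g b) < π (g c)}

theorem cornerQuadruples_eq_sum (π : Equiv.Perm (Fin N)) (a b c : Fin 4) :
    (cornerQuadruples π a b c : ℝ) = ∑ g : Fin 4 → Fin N,
      if (g 0 < g 2 ∧ g 1 < g 2) ∧ π (g a) < π (g c) ∧ π (g b) < π (g c) then 1 else 0 := by
  rw [cornerQuadruples, ← sum_boole]

theorem ite_and_and_and (p q r t : Prop) [Decidable p] [Decidable q] [Decidable r] [Decidable t] :
    (if (p ∧ q) ∧ r ∧ t then (1 : ℝ) else 0) =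
      (if p then 1 else 0) * (if q then 1 else 0) *
        ((if r then 1 else 0) * (if t then 1 else 0)) := by
  by_cases p <;> by_cases q <;> by_cases r <;> by_cases t <;> simp [*]

theorem cornerCount_eq_sum (π : Equiv.Perm (Fin N)) (i j : Fin N) :
    (cornerCount π i j : ℝ) =
      ∑ q, (if q < i then (1 : ℝ) else 0) * (if π q < j then 1 else 0) := by
  rw [cornerCount, ← sum_boole]
  refine sum_congr rfl fun v _ => ?_
  rw [ite_and, ite_mul, one_mul, zero_mul]
  rfl

theorem sum_ite_lt (i : Fin N) : ∑ q : Fin N, (if q < i then (1 : ℝ) else 0) = (i : ℕ) := by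
  have : #{q : Fin N | q < i} = (i : ℕ) := by
    rw [← Fin.card_Iio i]
    congr 1
    ext
    simp
  rw [sum_boole, this]

theorem sum_sq_cornerCount (π : Equiv.Perm (Fin N)) :
    ∑ i : Fin N, ∑ j : Fin N, (cornerCount π i j : ℝ) ^ 2 = cornerQuadruples π 0 1 3 := by
  rw [cornerQuadruples_eq_sum, sum_fin_four]
  refine sum_congr rfl fun c _ => ?_
  rw [← Equiv.sum_comp π]
  refine sum_congr rfl fun d _ => ?_
  rw [cornerCount_eq_sum, sq, sum_mul_sum]
  refine sum_congr rfl fun a _ => sum_congr rfl fun b _ => ?_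
  refine Eq.trans ?_ (ite_and_and_and (a < c) (b < c) (π a < π d) (π b < π d)).symm
  ring

theorem sum_sq_cornerCount_graph (π : Equiv.Perm (Fin N)) :
    N * ∑ p : Fin N, (cornerCount π p (π p) : ℝ) ^ 2 = cornerQuadruples π 0 1 2 := by
  rw [cornerQuadruples_eq_sum, sum_fin_four, mul_sum]
  refine sum_congr rfl fun c _ => ?_
  have : ∀ d : Fin N, (cornerCount π c (π c) : ℝ) ^ 2 = ∑ a, ∑ b,
      if ((![a, b, c, d] : Fin 4 → Fin N) 0 < (![a, b, c, d] : Fin 4 → Fin N) 2 ∧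
        (![a, b, c, d] : Fin 4 → Fin N) 1 < (![a, b, c, d] : Fin 4 → Fin N) 2) ∧
        π ((![a, b, c, d] : Fin 4 → Fin N) 0) < π ((![a, b, c, d] : Fin 4 → Fin N) 2) ∧
        π ((![a, b, c, d] : Fin 4 → Fin N) 1) < π ((![a, b, c, d] : Fin 4 → Fin N) 2)
      then 1 else 0 := by
    intro d
    rw [cornerCount_eq_sum, sq, sum_mul_sum]
    refine sum_congr rfl fun a _ => sum_congr rfl fun b _ => ?_
    refine Eq.trans ?_ (ite_and_and_and (a < c) (b < c) (π a < π c) (π b < π c)).symm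
    ring
  rw [← sum_congr rfl fun d _ => this d, sum_const, card_univ, Fintype.card_fin, nsmul_eq_mul]

theorem sum_cornerCount_graph_mul (π : Equiv.Perm (Fin N)) :
    ∑ p : Fin N, (cornerCount π p (π p) : ℝ) * ((p : ℕ) * (π p : ℕ)) =
      cornerQuadruples π 0 3 2 := by
  rw [cornerQuadruples_eq_sum, sum_fin_four]
  refine sum_congr rfl fun c _ => ?_
  rw [cornerCount_eq_sum, ← sum_ite_lt c, ← sum_ite_lt (π c),
    ← Equiv.sum_comp π fun q => if q < π c then (1 : ℝ) else 0, mul_comm, mul_assoc, sum_mul_sum,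
    sum_mul_sum, sum_comm]
  rw [sum_comm]
  simp only [mul_sum]
  rw [sum_comm]
  refine sum_congr rfl fun d _ => ?_
  rw [sum_comm]
  refine sum_congr rfl fun a _ => sum_congr rfl fun b _ => ?_
  refine Eq.trans ?_ (ite_and_and_and (a < c) (b < c) (π a < π c) (π d < π c)).symm
  ring

theorem sum_ite_gt_mul (q : Fin N) :
    ∑ i : Fin N, (if q < i then (1 : ℝ) else 0) * (i : ℕ) =
      ((N : ℝ) * (N - 1) - (q : ℕ) * ((q : ℕ) + 1)) / 2 := by
  have h : ∀ (q n : ℕ), q + 1 ≤ n → ∑ i ∈ range n, (if q < i then (1 : ℝ) else 0) * (i : ℕ) =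
      ((n : ℝ) * (n - 1) - q * (q + 1)) / 2 := by
    intro q n hn
    induction n, hn using Nat.le_induction with
    | base =>
      rw [sum_eq_zero fun i hi => ?_]
      · push_cast
        ring
      · rw [mem_range] at hi
        rw [if_neg (by omega), zero_mul]
    | succ n hn ih =>
      rw [sum_range_succ, ih, if_pos (by omega)]
      push_cast
      ring
  rw [← h q N q.2, Finset.sum_range]
  rfl

theorem sum_fin_sq : ∑ i : Fin N, ((i : ℕ) : ℝ) ^ 2 = N * (N - 1) * (2 * N - 1) / 6 := by
  rw [Fin.sum_univ_eq_sum_range fun i => (i : ℝ) ^ 2]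
  induction N with
  | zero => simp
  | succ n ih =>
    rw [sum_range_succ, ih]
    push_cast
    ring

theorem sum_fin_mul_succ :
    ∑ i : Fin N, ((i : ℕ) : ℝ) * ((i : ℕ) + 1) = (N - 1) * N * (N + 1) / 3 := by
  rw [Fin.sum_univ_eq_sum_range fun i => (i : ℝ) * (i + 1)]
  induction N with
  | zero => simp
  | succ n ih =>
    rw [sum_range_succ, ih]
    push_cast
    ring

theorem sum_cornerCount_mul (π : Equiv.Perm (Fin N)) :
    ∑ i : Fin N, ∑ j : Fin N, (cornerCount π i j : ℝ) * ((i : ℕ) * (j : ℕ)) =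
      ∑ q : Fin N, (((N : ℝ) * (N - 1) - (q : ℕ) * ((q : ℕ) + 1)) / 2) *
        (((N : ℝ) * (N - 1) - (π q : ℕ) * ((π q : ℕ) + 1)) / 2) := by
  simp only [← sum_ite_gt_mul, sum_mul_sum, cornerCount_eq_sum]
  simp only [sum_mul]
  rw [sum_congr rfl fun i _ => sum_comm, sum_comm]
  exact sum_congr rfl fun q _ => sum_congr rfl fun i _ => sum_congr rfl fun j _ => by ring

theorem le_sum_cornerCount_mul (hN : 1 ≤ N) (π : Equiv.Perm (Fin N)) :
    ((N : ℝ) ^ 5 / 3 - 4 / 3 * N ^ 4 + ∑ q : Fin N, (((q : ℕ) : ℝ) * (π q : ℕ)) ^ 2) / 4 ≤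
      ∑ i : Fin N, ∑ j : Fin N, (cornerCount π i j : ℝ) * ((i : ℕ) * (j : ℕ)) := by
  have hN' : (1 : ℝ) ≤ N := by exact_mod_cast hN
  have h1 : ∑ q : Fin N, ((π q : ℕ) : ℝ) * ((π q : ℕ) + 1) = (N - 1) * N * (N + 1) / 3 :=
    (Equiv.sum_comp π fun i : Fin N => ((i : ℕ) : ℝ) * ((i : ℕ) + 1)).trans sum_fin_mul_succ
  have h2 : ∑ i : Fin N, ∑ j : Fin N, (cornerCount π i j : ℝ) * ((i : ℕ) * (j : ℕ)) =
      (N * ((N : ℝ) * (N - 1)) ^ 2 - N * (N - 1) * ∑ q : Fin N, ((q : ℕ) : ℝ) * ((q : ℕ) + 1) -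
        N * (N - 1) * ∑ q : Fin N, ((π q : ℕ) : ℝ) * ((π q : ℕ) + 1) +
        ∑ q : Fin N, (((q : ℕ) : ℝ) * ((q : ℕ) + 1)) * (((π q : ℕ) : ℝ) *
          ((π q : ℕ) + 1))) / 4 := by
    have h3 : (N : ℝ) * ((N : ℝ) * (N - 1)) ^ 2 = ∑ q : Fin N, ((N : ℝ) * (N - 1)) ^ 2 := by
      rw [sum_const, card_univ, Fintype.card_fin, nsmul_eq_mul]
    rw [sum_cornerCount_mul, h3, mul_sum, mul_sum, ← sum_sub_distrib, ← sum_sub_distrib,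
      ← sum_add_distrib, sum_div]
    exact sum_congr rfl fun q _ => by ring
  have h3 : ∑ q : Fin N, (((q : ℕ) : ℝ) * (π q : ℕ)) ^ 2 ≤
      ∑ q : Fin N, (((q : ℕ) : ℝ) * ((q : ℕ) + 1)) * (((π q : ℕ) : ℝ) * ((π q : ℕ) + 1)) := by
    refine sum_le_sum fun q _ => ?_
    have hq : (0 : ℝ) ≤ (q : ℕ) := by positivity
    have hp : (0 : ℝ) ≤ (π q : ℕ) := by positivity
    calc (((q : ℕ) : ℝ) * (π q : ℕ)) ^ 2 =
          ((q : ℕ) : ℝ) * (q : ℕ) * (((π q : ℕ) : ℝ) * (π q : ℕ)) := by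
          ring
      _ ≤ _ := by gcongr <;> linarith
  rw [h2, h1, sum_fin_mul_succ]
  have h4 : (N : ℝ) ^ 5 / 3 - 4 / 3 * N ^ 4 ≤ N * ((N : ℝ) * (N - 1)) ^ 2 -
      N * (N - 1) * ((N - 1) * N * (N + 1) / 3) - N * (N - 1) * ((N - 1) * N * (N + 1) / 3) := by
    have h5 : 0 ≤ (N : ℝ) ^ 2 * (5 * N - 2) := by
      refine mul_nonneg (by positivity) (by linarith)
    linarith [h5, show N * ((N : ℝ) * (N - 1)) ^ 2 -
      N * (N - 1) * ((N - 1) * N * (N + 1) / 3) - N * (N - 1) * ((N - 1) * N * (N + 1) / 3) -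
      ((N : ℝ) ^ 5 / 3 - 4 / 3 * N ^ 4) = (N : ℝ) ^ 2 * (5 * N - 2) / 3 by ring]
  linarith

/-- The mean square corner deviation is controlled by counts of quadruples. -/
theorem sum_sq_cornerDisc_le (hN : 1 ≤ N) (π : Equiv.Perm (Fin N)) :
    ∑ i : Fin N, ∑ j : Fin N, cornerDisc π i j ^ 2 ≤
      (N : ℝ) ^ 2 * (cornerQuadruples π 0 1 3 + cornerQuadruples π 0 1 2 / 2 -
        cornerQuadruples π 0 3 2) - (N : ℝ) ^ 6 / 18 + 2 / 3 * (N : ℝ) ^ 5 := by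
  have hN' : (1 : ℝ) ≤ N := by exact_mod_cast hN
  have h1 : ∑ i : Fin N, ∑ j : Fin N, cornerDisc π i j ^ 2 =
      (N : ℝ) ^ 2 * ∑ i : Fin N, ∑ j : Fin N, (cornerCount π i j : ℝ) ^ 2 -
      2 * N * ∑ i : Fin N, ∑ j : Fin N, (cornerCount π i j : ℝ) * ((i : ℕ) * (j : ℕ)) +
      (∑ i : Fin N, ((i : ℕ) : ℝ) ^ 2) * ∑ i : Fin N, ((i : ℕ) : ℝ) ^ 2 := by
    rw [sum_mul_sum]
    simp only [mul_sum, ← sum_sub_distrib, ← sum_add_distrib, cornerDisc]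
    exact sum_congr rfl fun i _ => sum_congr rfl fun j _ => by ring
  have h2 : 0 ≤ (N : ℝ) ^ 2 * ∑ p : Fin N, (cornerCount π p (π p) : ℝ) ^ 2 -
      2 * N * ∑ p : Fin N, (cornerCount π p (π p) : ℝ) * ((p : ℕ) * (π p : ℕ)) +
      ∑ p : Fin N, (((p : ℕ) : ℝ) * (π p : ℕ)) ^ 2 := by
    simp only [mul_sum, ← sum_sub_distrib, ← sum_add_distrib]
    refine sum_nonneg fun p _ => ?_
    nlinarith [sq_nonneg ((N : ℝ) * cornerCount π p (π p) - ((p : ℕ) : ℝ) * (π p : ℕ))]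
  have h3 := le_sum_cornerCount_mul hN π
  have h4 : ∑ i : Fin N, ((i : ℕ) : ℝ) ^ 2 ≤ (N : ℝ) ^ 3 / 3 := by
    rw [sum_fin_sq]
    nlinarith [mul_nonneg (show (0 : ℝ) ≤ N by linarith) (show (0 : ℝ) ≤ 3 * N - 1 by linarith)]
  have h5 : (0 : ℝ) ≤ ∑ i : Fin N, ((i : ℕ) : ℝ) ^ 2 := sum_nonneg fun i _ => sq_nonneg _
  have h6 : (∑ i : Fin N, ((i : ℕ) : ℝ) ^ 2) * ∑ i : Fin N, ((i : ℕ) : ℝ) ^ 2 ≤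
      (N : ℝ) ^ 3 / 3 * ((N : ℝ) ^ 3 / 3) := mul_le_mul h4 h4 h5 (by positivity)
  rw [sum_cornerCount_graph_mul] at h2
  rw [h1, sum_sq_cornerCount, ← sum_sq_cornerCount_graph]
  have h7 := mul_le_mul_of_nonneg_left h3 (show (0 : ℝ) ≤ 2 * N by linarith)
  have h8 := mul_nonneg (show (0 : ℝ) ≤ N / 2 by linarith) h2
  nlinarith

/-- Up to degenerate quadruples, counts of quadruples are determined by pattern counts. -/
theorem cornerQuadruples_sub_mem (π : Equiv.Perm (Fin N)) (a b c : Fin 4) :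
    0 ≤ (cornerQuadruples π a b c : ℝ) -
        ∑ τ : Equiv.Perm (Fin 4), ∑ σ : Equiv.Perm (Fin 4),
          (if (τ 0 < τ 2 ∧ τ 1 < τ 2) ∧ σ.symm (τ a) < σ.symm (τ c) ∧ σ.symm (τ b) < σ.symm (τ c)
            then (1 : ℝ) else 0) * patternCount π σ ∧
      (cornerQuadruples π a b c : ℝ) -
        ∑ τ : Equiv.Perm (Fin 4), ∑ σ : Equiv.Perm (Fin 4),
          (if (τ 0 < τ 2 ∧ τ 1 < τ 2) ∧ σ.symm (τ a) < σ.symm (τ c) ∧ σ.symm (τ b) < σ.symm (τ c)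
            then (1 : ℝ) else 0) * patternCount π σ ≤ (N : ℝ) ^ 4 - 24 * N.choose 4 := by
  set Φ : (Fin 4 → Fin N) → ℝ := fun g =>
    if (g 0 < g 2 ∧ g 1 < g 2) ∧ π (g a) < π (g c) ∧ π (g b) < π (g c) then 1 else 0 with hΦ
  have h1 : ∑ τ : Equiv.Perm (Fin 4), ∑ σ : Equiv.Perm (Fin 4),
      (if (τ 0 < τ 2 ∧ τ 1 < τ 2) ∧ σ.symm (τ a) < σ.symm (τ c) ∧ σ.symm (τ b) < σ.symm (τ c)
        then (1 : ℝ) else 0) * patternCount π σ =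
      ∑ g : Fin 4 → Fin N, (if Function.Injective g then 1 else 0) * Φ g := by
    rw [sum_injective_eq]
    refine sum_congr rfl fun τ _ => ?_
    simp only [patternCount_eq_sum, mul_sum]
    rw [sum_comm]
    refine sum_congr rfl fun h _ => ?_
    by_cases hh : StrictMono h
    · have h2 := sum_strictMono_comp (π ∘ h)
      rw [if_pos (π.injective.comp hh.injective)] at h2
      simp only [if_pos hh, one_mul]
      calc _ = ∑ σ : Equiv.Perm (Fin 4),
            (if StrictMono ((π ∘ h) ∘ σ) then (1 : ℝ) else 0) * Φ (h ∘ τ) := by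
            refine sum_congr rfl fun σ _ => ?_
            by_cases hσ : StrictMono (π ∘ h ∘ σ)
            · have h3 : ∀ i j, π (h i) < π (h j) ↔ σ.symm i < σ.symm j := by
                intro i j
                rw [← hσ.lt_iff_lt]
                simp
              have hσ' : StrictMono ((π ∘ h) ∘ σ) := hσ
              rw [if_pos hσ, if_pos hσ', one_mul, mul_one]
              simp only [hΦ, Function.comp_apply, hh.lt_iff_lt, h3]
            · have hσ' : ¬ StrictMono ((π ∘ h) ∘ σ) := hσ
              rw [if_neg hσ, if_neg hσ']
              simp
        _ = Φ (h ∘ τ) := by rw [← sum_mul, h2, one_mul]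
    · simp [hh]
  have h2 : (N : ℝ) ^ 4 - 24 * N.choose 4 =
      ∑ g : Fin 4 → Fin N, (1 - if Function.Injective g then (1 : ℝ) else 0) := by
    rw [sum_sub_distrib, sum_injective]
    simp [Nat.factorial]
  rw [h1, h2, cornerQuadruples_eq_sum, ← sum_sub_distrib]
  have h3 : ∀ g, Φ g = 0 ∨ Φ g = 1 := fun g => by
    simp only [hΦ]
    split_ifs <;> simp
  constructor
  · refine sum_nonneg fun g _ => ?_
    change 0 ≤ Φ g - _
    rcases h3 g with h | h <;> rw [h] <;> split_ifs <;> norm_num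
  · refine sum_le_sum fun g _ => ?_
    change Φ g - _ ≤ _
    rcases h3 g with h | h <;> rw [h] <;> split_ifs <;> norm_num

end

section

open Filter Topology

theorem tendsto_choose_div_pow {N : ℕ → ℕ} (hN : Tendsto N atTop atTop) (s : ℕ) :
    Tendsto (fun k => ((N k).choose s : ℝ) / (N k : ℝ) ^ s) atTop
      (𝓝 (1 / (Nat.factorial s : ℝ))) := by
  have h : ∀ᶠ x : ℕ in atTop, ((x : ℝ) ^ s / (Nat.factorial s : ℝ)) ≠ 0 := by
    filter_upwards [eventually_ge_atTop 1] with x hx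
    have := Nat.factorial_pos s
    positivity
  have h1 := (Asymptotics.isEquivalent_iff_tendsto_one h).1 (isEquivalent_choose s)
  have h2 := (h1.comp hN).mul_const (1 / (Nat.factorial s : ℝ))
  rw [one_mul] at h2
  refine h2.congr fun k => ?_
  have h3 : (Nat.factorial s : ℝ) ≠ 0 := by positivity
  simp only [Function.comp_apply, Pi.div_apply]
  field_simp

/-- The normalized number of quadruples as in `cornerQuadruples` is asymptotically determined by
the pattern frequencies of order four. -/
theorem tendsto_cornerQuadruples {N : ℕ → ℕ} (hN : Tendsto N atTop atTop)
    {W : ∀ k, Equiv.Perm (Fin (N k)) → ℝ} (hW0 : ∀ k π, 0 ≤ W k π) (hW1 : ∀ k, ∑ π, W k π = 1)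
    (h4 : ∀ σ : Equiv.Perm (Fin 4), Tendsto
      (fun k => ∑ π, W k π * ((patternCount π σ : ℝ) / (N k).choose 4)) atTop
      (𝓝 (1 / (Nat.factorial 4 : ℝ)))) {a b c : Fin 4}
    (habc : #{p : Equiv.Perm (Fin 4) × Equiv.Perm (Fin 4) | (p.1 0 < p.1 2 ∧ p.1 1 < p.1 2) ∧
      p.2.symm (p.1 a) < p.2.symm (p.1 c) ∧ p.2.symm (p.1 b) < p.2.symm (p.1 c)} = 64) :
    Tendsto (fun k => ∑ π, W k π * ((cornerQuadruples π a b c : ℝ) / (N k : ℝ) ^ 4)) atTop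
      (𝓝 (1 / 9)) := by
  set I : Equiv.Perm (Fin 4) → Equiv.Perm (Fin 4) → ℝ := fun τ σ =>
    if (τ 0 < τ 2 ∧ τ 1 < τ 2) ∧ σ.symm (τ a) < σ.symm (τ c) ∧ σ.symm (τ b) < σ.symm (τ c)
      then 1 else 0 with hI
  have hI64 : ∑ τ, ∑ σ, I τ σ = 64 := by
    rw [← Fintype.sum_prod_type', sum_boole, habc]
    norm_num
  have hC := tendsto_choose_div_pow hN 4
  have hL : Tendsto (fun k => ((N k).choose 4 : ℝ) / (N k : ℝ) ^ 4 *
      ∑ τ, ∑ σ, I τ σ * ∑ π, W k π * ((patternCount π σ : ℝ) / (N k).choose 4)) atTop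
      (𝓝 (1 / 9)) := by
    have h := hC.mul (tendsto_finsetSum univ fun τ _ => tendsto_finsetSum univ fun σ _ =>
      (h4 σ).const_mul (I τ σ))
    convert h using 2
    simp only [← sum_mul, hI64]
    norm_num [Nat.factorial]
  have hU : Tendsto (fun k => ((N k).choose 4 : ℝ) / (N k : ℝ) ^ 4 *
      (∑ τ, ∑ σ, I τ σ * ∑ π, W k π * ((patternCount π σ : ℝ) / (N k).choose 4)) +
      (1 - 24 * (((N k).choose 4 : ℝ) / (N k : ℝ) ^ 4))) atTop (𝓝 (1 / 9)) := by
    have h := hL.add ((hC.const_mul 24).const_sub 1)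
    convert h using 2
    norm_num [Nat.factorial]
  have hS : ∀ k, 4 ≤ N k → ((N k).choose 4 : ℝ) / (N k : ℝ) ^ 4 *
      (∑ τ, ∑ σ, I τ σ * ∑ π, W k π * ((patternCount π σ : ℝ) / (N k).choose 4)) =
      ∑ π, W k π * ((∑ τ, ∑ σ, I τ σ * patternCount π σ) / (N k : ℝ) ^ 4) := by
    intro k hk
    have h1 : ((N k).choose 4 : ℝ) ≠ 0 := by
      exact_mod_cast (Nat.choose_pos hk).ne'
    simp only [mul_sum, sum_div]
    refine Eq.trans ?_ ((sum_congr rfl fun τ _ => sum_comm).trans sum_comm)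
    refine sum_congr rfl fun τ _ => sum_congr rfl fun σ _ => sum_congr rfl fun π _ => ?_
    field_simp
  refine tendsto_of_tendsto_of_tendsto_of_le_of_le' hL hU ?_ ?_
  · filter_upwards [hN.eventually_ge_atTop 4] with k hk
    rw [hS k hk]
    refine sum_le_sum fun π _ => mul_le_mul_of_nonneg_left ?_ (hW0 k π)
    have := (cornerQuadruples_sub_mem π a b c).1
    gcongr
    linarith
  · filter_upwards [hN.eventually_ge_atTop 4] with k hk
    have hk' : (0 : ℝ) < (N k : ℝ) := by exact_mod_cast (by omega : 0 < N k)
    have h2 : (1 : ℝ) - 24 * (((N k).choose 4 : ℝ) / (N k : ℝ) ^ 4) =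
        ∑ π, W k π * (((N k : ℝ) ^ 4 - 24 * (N k).choose 4) / (N k : ℝ) ^ 4) := by
      rw [← sum_mul, hW1, one_mul]
      field_simp
    rw [hS k hk, h2, ← sum_add_distrib]
    refine sum_le_sum fun π _ => ?_
    rw [← mul_add]
    refine mul_le_mul_of_nonneg_left ?_ (hW0 k π)
    have h1 := (cornerQuadruples_sub_mem π a b c).2
    rw [← add_div]
    gcongr
    linarith

theorem card_cornerQuadruples_pattern :
    #{p : Equiv.Perm (Fin 4) × Equiv.Perm (Fin 4) | (p.1 0 < p.1 2 ∧ p.1 1 < p.1 2) ∧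
      p.2.symm (p.1 0) < p.2.symm (p.1 3) ∧ p.2.symm (p.1 1) < p.2.symm (p.1 3)} = 64 ∧
    #{p : Equiv.Perm (Fin 4) × Equiv.Perm (Fin 4) | (p.1 0 < p.1 2 ∧ p.1 1 < p.1 2) ∧
      p.2.symm (p.1 0) < p.2.symm (p.1 2) ∧ p.2.symm (p.1 1) < p.2.symm (p.1 2)} = 64 ∧
    #{p : Equiv.Perm (Fin 4) × Equiv.Perm (Fin 4) | (p.1 0 < p.1 2 ∧ p.1 1 < p.1 2) ∧
      p.2.symm (p.1 0) < p.2.symm (p.1 2) ∧ p.2.symm (p.1 3) < p.2.symm (p.1 2)} = 64 := by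
  decide +kernel

/-- If a mixture of permutations has asymptotically uniform patterns of order four, then the
average maximal corner deviation is negligible. -/
theorem exists_tendsto_cornerDisc_bound {N : ℕ → ℕ} (hN : Tendsto N atTop atTop)
    {W : ∀ k, Equiv.Perm (Fin (N k)) → ℝ} (hW0 : ∀ k π, 0 ≤ W k π) (hW1 : ∀ k, ∑ π, W k π = 1)
    (h4 : ∀ σ : Equiv.Perm (Fin 4), Tendsto
      (fun k => ∑ π, W k π * ((patternCount π σ : ℝ) / (N k).choose 4)) atTop
      (𝓝 (1 / (Nat.factorial 4 : ℝ)))) :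
    ∃ M : ∀ k, Equiv.Perm (Fin (N k)) → ℝ,
      (∀ k π, ∀ i ≤ N k, ∀ j ≤ N k, |cornerDisc π i j| ≤ M k π) ∧
      Tendsto (fun k => ∑ π, W k π * (M k π / (N k : ℝ) ^ 2)) atTop (𝓝 0) := by
  choose M hM0 hM hM4 using fun k => exists_cornerDisc_bound (N := N k)
  refine ⟨M, hM, ?_⟩
  obtain ⟨c1, c2, c3⟩ := card_cornerQuadruples_pattern
  have t1 := tendsto_cornerQuadruples hN hW0 hW1 h4 c1
  have t2 := tendsto_cornerQuadruples hN hW0 hW1 h4 c2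
  have t3 := tendsto_cornerQuadruples hN hW0 hW1 h4 c3
  have t4 : Tendsto (fun k => (N k : ℝ)⁻¹) atTop (𝓝 0) :=
    tendsto_inv_atTop_nhds_zero_nat.comp hN
  have hR : Tendsto (fun k => 64 * (∑ π, W k π * ((cornerQuadruples π 0 1 3 : ℝ) / (N k : ℝ) ^ 4) +
      (∑ π, W k π * ((cornerQuadruples π 0 1 2 : ℝ) / (N k : ℝ) ^ 4)) / 2 -
      ∑ π, W k π * ((cornerQuadruples π 0 3 2 : ℝ) / (N k : ℝ) ^ 4) +
      (2 / 3 * (N k : ℝ)⁻¹ - 1 / 18))) atTop (𝓝 0) := by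
    have h := ((((t1.add (t2.div_const 2)).sub t3).add
      ((t4.const_mul (2 / 3)).sub_const (1 / 18))).const_mul 64)
    convert h using 2
    norm_num
  have hy0 : ∀ k, 0 ≤ ∑ π, W k π * (M k π / (N k : ℝ) ^ 2) := fun k =>
    sum_nonneg fun π _ => mul_nonneg (hW0 k π) (div_nonneg (hM0 k π) (by positivity))
  have hy4 : Tendsto (fun k => (∑ π, W k π * (M k π / (N k : ℝ) ^ 2)) ^ 4) atTop (𝓝 0) := by
    refine squeeze_zero' (Eventually.of_forall fun k => pow_nonneg (hy0 k) 4) ?_ hR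
    filter_upwards [hN.eventually_ge_atTop 1] with k hk
    have hk' : (0 : ℝ) < (N k : ℝ) := by exact_mod_cast hk
    refine (Real.pow_arith_mean_le_arith_mean_pow univ (W k) (fun π => M k π / (N k : ℝ) ^ 2)
      (fun π _ => hW0 k π) (hW1 k) (fun π _ => div_nonneg (hM0 k π) (by positivity)) 4).trans ?_
    have h1 : 2 / 3 * (N k : ℝ)⁻¹ - 1 / 18 =
        ∑ π, W k π * (2 / 3 * (N k : ℝ)⁻¹ - 1 / 18) := by
      rw [← sum_mul, hW1, one_mul]
    rw [h1, sum_div, ← sum_add_distrib, ← sum_sub_distrib, ← sum_add_distrib, mul_sum]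
    refine sum_le_sum fun π _ => ?_
    have h2 : (M k π / (N k : ℝ) ^ 2) ^ 4 ≤ 64 * ((cornerQuadruples π 0 1 3 : ℝ) / (N k : ℝ) ^ 4 +
        (cornerQuadruples π 0 1 2 : ℝ) / (N k : ℝ) ^ 4 / 2 -
        (cornerQuadruples π 0 3 2 : ℝ) / (N k : ℝ) ^ 4 + (2 / 3 * (N k : ℝ)⁻¹ - 1 / 18)) := by
      have h3 := (hM4 k π).trans (mul_le_mul_of_nonneg_left (sum_sq_cornerDisc_le hk π)
        (by positivity))
      calc (M k π / (N k : ℝ) ^ 2) ^ 4 = M k π ^ 4 / (N k : ℝ) ^ 8 := by ring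
        _ ≤ _ := div_le_div_of_nonneg_right h3 (by positivity)
        _ = _ := by
          field_simp
          ring
    calc _ ≤ _ := mul_le_mul_of_nonneg_left h2 (hW0 k π)
      _ = _ := by ring
  have h := hy4.rpow_const (p := 1 / 4) (Or.inr (by norm_num))
  rw [Real.zero_rpow (by norm_num)] at h
  refine h.congr fun k => ?_
  rw [← Real.rpow_natCast, ← Real.rpow_mul (hy0 k)]
  norm_num

/-- If a mixture of permutations has asymptotically uniform patterns of order four, then it has
asymptotically uniform patterns of every order. -/
theorem tendsto_patternCount {N : ℕ → ℕ} (hN : Tendsto N atTop atTop)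
    {W : ∀ k, Equiv.Perm (Fin (N k)) → ℝ} (hW0 : ∀ k π, 0 ≤ W k π) (hW1 : ∀ k, ∑ π, W k π = 1)
    (h4 : ∀ σ : Equiv.Perm (Fin 4), Tendsto
      (fun k => ∑ π, W k π * ((patternCount π σ : ℝ) / (N k).choose 4)) atTop
      (𝓝 (1 / (Nat.factorial 4 : ℝ)))) {s : ℕ} (σ : Equiv.Perm (Fin s)) :
    Tendsto (fun k => ∑ π, W k π * ((patternCount π σ : ℝ) / (N k).choose s)) atTop
      (𝓝 (1 / (Nat.factorial s : ℝ))) := by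
  obtain ⟨M, hM, hy⟩ := exists_tendsto_cornerDisc_bound hN hW0 hW1 h4
  have hc := tendsto_choose_div_pow hN s
  have hs : (1 / (Nat.factorial s : ℝ)) ≠ 0 := by positivity
  have hb : Tendsto (fun k => 4 * s / (((N k).choose s : ℝ) / (N k : ℝ) ^ s) *
      ∑ π, W k π * (M k π / (N k : ℝ) ^ 2)) atTop (𝓝 0) := by
    simpa using ((tendsto_const_nhds (x := 4 * (s : ℝ))).div hc hs).mul hy
  have hd : Tendsto (fun k => ∑ π, W k π * ((patternCount π σ : ℝ) / (N k).choose s) -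
      ((N k).choose s : ℝ) / (N k : ℝ) ^ s) atTop (𝓝 0) := by
    refine squeeze_zero_norm' ?_ hb
    filter_upwards [hN.eventually_ge_atTop (s + 1)] with k hk
    have hk' : (0 : ℝ) < (N k : ℝ) := by exact_mod_cast (by omega : 0 < N k)
    have hC : (0 : ℝ) < ((N k).choose s : ℝ) := by
      exact_mod_cast Nat.choose_pos (by omega : s ≤ N k)
    have h1 : ((N k).choose s : ℝ) / (N k : ℝ) ^ s =
        ∑ π, W k π * (((N k).choose s : ℝ) / (N k : ℝ) ^ s) := by
      rw [← sum_mul, hW1, one_mul]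
    rw [mul_sum, Real.norm_eq_abs]
    nth_rw 1 [h1]
    rw [← sum_sub_distrib]
    refine (abs_sum_le_sum_abs _ _).trans (sum_le_sum fun π _ => ?_)
    rw [← mul_sub, abs_mul, abs_of_nonneg (hW0 k π)]
    have h2 : |(patternCount π σ : ℝ) / (N k).choose s - ((N k).choose s : ℝ) / (N k : ℝ) ^ s| ≤
        4 * s / (((N k).choose s : ℝ) / (N k : ℝ) ^ s) * (M k π / (N k : ℝ) ^ 2) := by
      have h3 := abs_patternCount_sub_le π σ (hM k π)
      have h4 : (patternCount π σ : ℝ) / (N k).choose s - ((N k).choose s : ℝ) / (N k : ℝ) ^ s =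
          ((N k : ℝ) ^ s * patternCount π σ - ((N k).choose s : ℝ) ^ 2) /
            ((N k : ℝ) ^ s * (N k).choose s) := by
        field_simp
      rw [h4, abs_div, abs_of_pos (mul_pos (pow_pos hk' s) hC), div_le_iff₀ (by positivity)]
      refine le_of_mul_le_mul_left (h3.trans_eq ?_) (pow_pos hk' 2)
      field_simp
      ring
    calc _ ≤ _ := mul_le_mul_of_nonneg_left h2 (hW0 k π)
      _ = _ := by ring
  simpa using hd.add hc

end

/-- **Four-point test suffices.** If a sequence of random bipartite multigraphs (probability
distributions `μ k` over edge lists, with `n k` left vertices, `m k` right vertices and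
`N k` edges, all tending to infinity) is asymptotically block-free of order 4, then it is
asymptotically block-free of order `s` for every `s ≥ 2`. -/
theorem four_point_suffices
    (n m N : ℕ → ℕ)
    (μ : ∀ k, PMF (Fin (N k) → Fin (n k) × Fin (m k)))
    (hn : Filter.Tendsto n Filter.atTop Filter.atTop)
    (hm : Filter.Tendsto m Filter.atTop Filter.atTop)
    (hN : Filter.Tendsto N Filter.atTop Filter.atTop)
    (h4 : ∀ σ : Equiv.Perm (Fin 4),
      Filter.Tendsto
        (fun k => ∑ e : Fin (N k) → Fin (n k) × Fin (m k),
          ((μ k) e).toReal * inducedProb e 4 σ)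
        Filter.atTop (nhds (1 / (Nat.factorial 4 : ℝ)))) :
    ∀ s : ℕ, 2 ≤ s → ∀ σ : Equiv.Perm (Fin s),
      Filter.Tendsto
        (fun k => ∑ e : Fin (N k) → Fin (n k) × Fin (m k),
          ((μ k) e).toReal * inducedProb e s σ)
        Filter.atTop (nhds (1 / (Nat.factorial s : ℝ))) := by
  choose w hw0 hw1 hw using fun k =>
    exists_weights_inducedProb (N := N k) (n := n k) (m := m k)
  have hμ : ∀ k, ∑ e, ((μ k) e).toReal = 1 := by
    intro k
    rw [← ENNReal.toReal_sum fun e _ => (μ k).apply_ne_top e,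
      ← tsum_fintype (L := .unconditional _),
      (μ k).tsum_coe, ENNReal.toReal_one]
  have hind : ∀ k s (σ : Equiv.Perm (Fin s)),
      ∑ e : Fin (N k) → Fin (n k) × Fin (m k), ((μ k) e).toReal * inducedProb e s σ =
        ∑ π, (∑ e, ((μ k) e).toReal * w k e π) *
          ((patternCount π σ : ℝ) / (N k).choose s) := by
    intro k s σ
    simp only [sum_mul, hw, mul_sum]
    rw [sum_comm]
    exact sum_congr rfl fun π _ => sum_congr rfl fun e _ => (mul_assoc _ _ _).symm
  intro s _ σ
  simp only [hind] at h4 ⊢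
  refine tendsto_patternCount hN (fun k π => sum_nonneg fun e _ =>
    mul_nonneg ENNReal.toReal_nonneg (hw0 k e π)) (fun k => ?_) h4 σ
  rw [sum_comm, ← hμ k]
  exact sum_congr rfl fun e _ => by rw [← mul_sum, hw1, mul_one]

end FourPointTest
end

section
/- Let (τ_j) be a sequence of permutations whose lengths tend to infinity, and suppose that t(π, τ_j) → 1/24 as j → ∞ for every π ∈ S_4. Then for every integer k ≥ 2 and every π ∈ S_k, t(π, τ_j) → 1/k! as j → ∞; that is, Property P(4) implies Property P(k) for all k ≥ 2. -/
namespace QuasirandomPerm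

/-- `t π τ`: the probability that a uniformly random `k`-element subset
`X = {x_1 < … < x_k}` of `{1,…,m}` induces a permutation isomorphic to `π`, i.e. that the
standardization of `(τ(x_1),…,τ(x_k))` equals `π`.  Strictly monotone maps
`Fin k → Fin m` are in bijection with `k`-element subsets of `Fin m`. -/
noncomputable def patProb {k m : ℕ} (π : Equiv.Perm (Fin k)) (τ : Equiv.Perm (Fin m)) : ℝ :=
  (Nat.card {g : Fin k → Fin m // StrictMono g ∧
      ∀ i j : Fin k, π i < π j ↔ τ (g i) < τ (g j)} : ℝ) / (m.choose k : ℝ)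

open Filter Topology Finset Function

set_option maxRecDepth 100000 in
theorem card_perm_two_lt : ∀ u v w : Fin 4, u ≠ v → w ≠ v → u ≠ w →
    #{σ : Equiv.Perm (Fin 4) | σ u < σ v ∧ σ w < σ v} = 8 := by
  decide +kernel

open scoped Classical

theorem existsUnique_strictMono_comp_symm {k n : ℕ} {p : Fin k → Fin n} (hp : Injective p) :
    ∃! σ : Equiv.Perm (Fin k), StrictMono (p ∘ σ.symm) := by
  refine ⟨(Tuple.sort p).symm, ?_, fun ρ hρ => ?_⟩
  · exact (Tuple.monotone_sort p).strictMono_of_injective (hp.comp (Equiv.injective _))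
  · have hs : StrictMono (p ∘ (Tuple.sort p)) :=
      (Tuple.monotone_sort p).strictMono_of_injective (hp.comp (Equiv.injective _))
    have h : p ∘ ρ.symm = p ∘ Tuple.sort p := by
      rw [← StrictMono.range_inj hρ hs]
      simp [Set.range_comp]
    refine Equiv.ext fun i => ?_
    have := congrFun h (ρ i)
    simp only [comp_apply, Equiv.symm_apply_apply] at this
    exact (Equiv.eq_symm_apply _).2 (hp this).symm

theorem sum_perm_strictMono {k n : ℕ} (p : Fin k → Fin n) :
    ∑ σ : Equiv.Perm (Fin k), (if StrictMono (p ∘ σ.symm) then (1 : ℝ) else 0)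
      = if Injective p then 1 else 0 := by
  split_ifs with hp
  · obtain ⟨σ, hσ, hu⟩ := existsUnique_strictMono_comp_symm hp
    rw [Finset.sum_eq_single σ]
    · rw [if_pos hσ]
    · intro ρ _ hρ
      exact if_neg fun h => hρ (hu ρ h)
    · simp
  · refine Finset.sum_eq_zero fun σ _ => if_neg fun h => hp ?_
    have := h.injective.comp σ.injective
    simpa [comp_assoc] using this

/-- The number of occurrences of the pattern `π` in `τ`. -/
noncomputable def patCount {k n : ℕ} (π : Equiv.Perm (Fin k)) (τ : Equiv.Perm (Fin n)) : ℝ :=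
  ∑ g : Fin k → Fin n, if StrictMono g ∧ StrictMono (τ ∘ g ∘ π.symm) then 1 else 0

theorem strictMono_comp_symm_iff {k n : ℕ} (π : Equiv.Perm (Fin k)) (h : Fin k → Fin n) :
    StrictMono (h ∘ π.symm) ↔ ∀ i j, π i < π j ↔ h i < h j := by
  constructor
  · intro hs i j
    have := hs.lt_iff_lt (a := π i) (b := π j)
    simpa using this.symm
  · intro H i j hij
    exact (H _ _).1 (by simpa using hij)

theorem patProb_eq {k n : ℕ} (π : Equiv.Perm (Fin k)) (τ : Equiv.Perm (Fin n)) :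
    patProb π τ = patCount π τ / (n.choose k : ℝ) := by
  unfold patProb patCount
  congr 1
  rw [Nat.card_eq_fintype_card, Fintype.card_subtype, Finset.sum_boole]
  congr 2
  ext g
  simp only [mem_filter, mem_univ, true_and]
  rw [← strictMono_comp_symm_iff π (fun i => τ (g i))]
  rfl

theorem card_strictMono (k n : ℕ) :
    ∑ g : Fin k → Fin n, (if StrictMono g then (1 : ℝ) else 0) = n.choose k := by
  rw [Finset.sum_boole, ← Finset.card_fin n, ← Finset.card_powersetCard, Finset.card_fin n]
  congr 1
  refine Finset.card_bij (fun g _ => univ.image g) ?_ ?_ ?_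
  · intro g hg
    simp only [mem_filter, mem_univ, true_and] at hg
    simp [mem_powersetCard, Finset.card_image_of_injective _ hg.injective]
  · intro g hg h hh e
    simp only [mem_filter, mem_univ, true_and] at hg hh
    rw [← StrictMono.range_inj hg hh]
    simpa using congrArg (fun s : Finset (Fin n) => (s : Set (Fin n))) e
  · intro s hs
    have hs : s.card = k := (mem_powersetCard.1 hs).2
    refine ⟨s.orderEmbOfFin hs, by simp [OrderEmbedding.strictMono], ?_⟩
    simp

theorem patCount_comp {k n : ℕ} (σ ρ : Equiv.Perm (Fin k)) (τ : Equiv.Perm (Fin n)) :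
    ∑ p : Fin k → Fin n,
      (if StrictMono (p ∘ σ.symm) ∧ StrictMono ((τ ∘ p) ∘ ρ.symm) then (1 : ℝ) else 0)
      = patCount (ρ * σ⁻¹) τ := by
  unfold patCount
  refine Fintype.sum_equiv (σ.arrowCongr (Equiv.refl _)) _ _ fun p => ?_
  congr 2
  rw [eq_iff_iff]
  have : (τ ∘ p) ∘ ρ.symm = τ ∘ (p ∘ σ.symm) ∘ ⇑(Equiv.symm (ρ * σ⁻¹)) := by
    ext i; simp [Equiv.Perm.mul_def, Equiv.Perm.inv_def]
  rw [this]; rfl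

theorem sum_injective_eq {k n : ℕ} (τ : Equiv.Perm (Fin n)) (A A' : Equiv.Perm (Fin k) → Prop)
    (B : (Fin k → Fin n) → Prop) [DecidablePred A] [DecidablePred A'] [DecidablePred B]
    (hB : ∀ p (σ ρ : Equiv.Perm (Fin k)), StrictMono (p ∘ σ.symm) →
      StrictMono ((τ ∘ p) ∘ ρ.symm) → (B p ↔ A σ ∧ A' ρ)) :
    ∑ p : Fin k → Fin n, (if Injective p ∧ B p then (1 : ℝ) else 0)
      = ∑ σ, ∑ ρ, if A σ ∧ A' ρ then patCount (ρ * σ⁻¹) τ else 0 := by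
  have key : ∀ p : Fin k → Fin n, (if Injective p ∧ B p then (1 : ℝ) else 0)
      = ∑ σ : Equiv.Perm (Fin k), ∑ ρ : Equiv.Perm (Fin k), if A σ ∧ A' ρ then
        (if StrictMono (p ∘ σ.symm) ∧ StrictMono ((τ ∘ p) ∘ ρ.symm) then (1 : ℝ) else 0)
        else 0 := by
    intro p
    have h1 : (if Injective p ∧ B p then (1 : ℝ) else 0) =
        (if B p then 1 else 0) * ((if Injective p then 1 else 0) *
          (if Injective (τ ∘ p) then 1 else 0)) := by
      have := τ.injective.of_comp_iff p
      by_cases h : Injective p <;> by_cases h' : B p <;> simp [h, h', this]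
    rw [h1, ← sum_perm_strictMono, ← sum_perm_strictMono, Finset.sum_mul_sum, Finset.mul_sum]
    refine sum_congr rfl fun σ _ => ?_
    rw [Finset.mul_sum]
    refine sum_congr rfl fun ρ _ => ?_
    by_cases h : StrictMono (p ∘ σ.symm)
    · by_cases h' : StrictMono ((τ ∘ p) ∘ ρ.symm)
      · simp [hB p σ ρ h h', h, h']
      · simp [h, h']
    · simp [h]
  rw [sum_congr rfl fun p _ => key p, sum_comm]
  refine sum_congr rfl fun σ _ => ?_
  rw [sum_comm]
  refine sum_congr rfl fun ρ _ => ?_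
  split_ifs
  · exact patCount_comp σ ρ τ
  · simp

theorem sum_fin_succ_arrow {m : ℕ} {α : Type*} [Fintype α] (f : (Fin (m + 1) → α) → ℝ) :
    ∑ p, f p = ∑ a, ∑ q : Fin m → α, f (Fin.cons a q) := by
  rw [← Fintype.sum_prod_type']
  exact (Fintype.sum_equiv (Fin.consEquiv fun _ => α) _ _ fun _ => rfl).symm

theorem sum_fin_four_arrow {α : Type*} [Fintype α] (f : α → α → α → α → ℝ) :
    ∑ p : Fin 4 → α, f (p 0) (p 1) (p 2) (p 3) = ∑ a, ∑ b, ∑ c, ∑ d, f a b c d := by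
  simp only [sum_fin_succ_arrow, Fintype.sum_unique]
  rfl

theorem choose_div_pow_tendsto (k : ℕ) :
    Tendsto (fun n : ℕ => (n.choose k : ℝ) / (n : ℝ) ^ k) atTop (𝓝 (1 / (k.factorial : ℝ))) := by
  have h : Tendsto (fun n : ℕ => (n : ℝ) * (1 / (n : ℝ))) atTop (𝓝 1) := by
    refine tendsto_const_nhds.congr' ?_
    filter_upwards [eventually_gt_atTop 0] with n hn
    field_simp
  simpa [div_eq_mul_inv] using ProbabilityTheory.tendsto_choose_mul_pow_atTop k h

theorem sum_injective (k n : ℕ) :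
    ∑ p : Fin k → Fin n, (if Injective p then (1 : ℝ) else 0) = k.factorial * n.choose k := by
  simp_rw [← sum_perm_strictMono]
  rw [sum_comm]
  have : ∀ σ : Equiv.Perm (Fin k), ∑ p : Fin k → Fin n,
      (if StrictMono (p ∘ σ.symm) then (1 : ℝ) else 0) = n.choose k := fun σ => by
    rw [← card_strictMono]
    exact Fintype.sum_equiv (σ.arrowCongr (Equiv.refl _)) _ _ fun p => rfl
  simp [this, Fintype.card_perm]

theorem abs_sum_sub_sum_injective_le {k n : ℕ} (B : (Fin k → Fin n) → Prop)
    [DecidablePred B] :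
    |∑ p, (if B p then (1 : ℝ) else 0) - ∑ p, (if Injective p ∧ B p then (1 : ℝ) else 0)|
      ≤ (n : ℝ) ^ k - k.factorial * n.choose k := by
  have h : ((n : ℝ) ^ k) = ∑ _p : Fin k → Fin n, (1 : ℝ) := by simp
  rw [← sum_injective, h, ← sum_sub_distrib, ← sum_sub_distrib]
  refine (abs_sum_le_sum_abs _ _).trans (sum_le_sum fun p _ => ?_)
  by_cases h : Injective p <;> by_cases h' : B p <;> simp [h, h']

section Limits

variable {ℓ : ℕ → ℕ} {τ : ∀ j, Equiv.Perm (Fin (ℓ j))} {k : ℕ}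

theorem patCount_tendsto (hℓ : Tendsto ℓ atTop atTop) {π : Equiv.Perm (Fin k)} {c : ℝ}
    (h : Tendsto (fun j => patProb π (τ j)) atTop (𝓝 c)) :
    Tendsto (fun j => patCount π (τ j) / (ℓ j : ℝ) ^ k) atTop (𝓝 (c / (k.factorial : ℝ))) := by
  have := h.mul ((choose_div_pow_tendsto k).comp hℓ)
  rw [mul_one_div] at this
  refine this.congr' ?_
  filter_upwards [hℓ.eventually_ge_atTop k] with j hj
  have : ((ℓ j).choose k : ℝ) ≠ 0 := by
    exact_mod_cast (Nat.choose_pos hj).ne'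
  simp only [patProb_eq, comp_apply]
  field_simp

theorem tuple_tendsto (hℓ : Tendsto ℓ atTop atTop)
    (h : ∀ π : Equiv.Perm (Fin k),
      Tendsto (fun j => patProb π (τ j)) atTop (𝓝 (1 / (k.factorial : ℝ))))
    (A A' : Equiv.Perm (Fin k) → Prop) (B : ∀ j, (Fin k → Fin (ℓ j)) → Prop)
    [DecidablePred A] [DecidablePred A'] [∀ j, DecidablePred (B j)]
    (hB : ∀ j p (σ ρ : Equiv.Perm (Fin k)), StrictMono (p ∘ σ.symm) →
      StrictMono ((τ j ∘ p) ∘ ρ.symm) → (B j p ↔ A σ ∧ A' ρ)) :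
    Tendsto (fun j => (∑ p, if B j p then (1 : ℝ) else 0) / (ℓ j : ℝ) ^ k) atTop
      (𝓝 ((#{σ | A σ} : ℝ) * #{σ | A' σ} / (k.factorial : ℝ) ^ 2)) := by
  have h1 : Tendsto (fun j => (∑ p, if Injective p ∧ B j p then (1 : ℝ) else 0) / (ℓ j : ℝ) ^ k)
      atTop (𝓝 ((#{σ | A σ} : ℝ) * #{σ | A' σ} / (k.factorial : ℝ) ^ 2)) := by
    have h2 : Tendsto (fun j => ∑ σ, ∑ ρ, if A σ ∧ A' ρ then
        patCount (ρ * σ⁻¹) (τ j) / (ℓ j : ℝ) ^ k else 0) atTop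
        (𝓝 (∑ σ, ∑ ρ, if A σ ∧ A' ρ then 1 / (k.factorial : ℝ) / (k.factorial : ℝ) else 0)) := by
      refine tendsto_finsetSum _ fun σ _ => tendsto_finsetSum _ fun ρ _ => ?_
      split_ifs
      · exact patCount_tendsto hℓ (h _)
      · exact tendsto_const_nhds
    convert h2 using 2
    · rw [sum_injective_eq _ A A' _ (hB _), sum_div]
      refine sum_congr rfl fun σ _ => ?_
      rw [sum_div]
      refine sum_congr rfl fun ρ _ => ?_
      split_ifs <;> simp
    · rw [← sum_boole, ← sum_boole, sum_mul_sum, sum_div]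
      refine sum_congr rfl fun σ _ => ?_
      rw [sum_div]
      refine sum_congr rfl fun ρ _ => ?_
      by_cases hA : A σ <;> by_cases hA' : A' ρ <;> simp [hA, hA', sq, div_eq_mul_inv]
  have h3 : Tendsto (fun j => (∑ p, if B j p then (1 : ℝ) else 0) / (ℓ j : ℝ) ^ k -
      (∑ p, if Injective p ∧ B j p then (1 : ℝ) else 0) / (ℓ j : ℝ) ^ k) atTop (𝓝 0) := by
    have h4 : Tendsto (fun j => 1 - (k.factorial : ℝ) * (((ℓ j).choose k : ℝ) / (ℓ j : ℝ) ^ k))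
        atTop (𝓝 0) := by
      have := (((choose_div_pow_tendsto k).comp hℓ).const_mul (k.factorial : ℝ)).const_sub 1
      have hk : (k.factorial : ℝ) ≠ 0 := by positivity
      rwa [mul_one_div_cancel hk, sub_self] at this
    refine squeeze_zero_norm' ?_ h4
    filter_upwards [hℓ.eventually_gt_atTop 0] with j hj
    have hj' : (0 : ℝ) < (ℓ j : ℝ) ^ k := by positivity
    rw [← sub_div, Real.norm_eq_abs, abs_div, abs_of_pos hj', div_le_iff₀ hj']
    refine (abs_sum_sub_sum_injective_le _).trans (le_of_eq ?_)
    field_simp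
  simpa using h3.add h1

theorem lt_iff_of_strictMono_comp_symm {n : ℕ} {p : Fin k → Fin n} {σ : Equiv.Perm (Fin k)}
    (h : StrictMono (p ∘ σ.symm)) (i j : Fin k) : p i < p j ↔ σ i < σ j :=
  ((strictMono_comp_symm_iff σ p).1 h i j).symm

theorem quadruple_tendsto (hℓ : Tendsto ℓ atTop atTop)
    (h : ∀ π : Equiv.Perm (Fin 4),
      Tendsto (fun j => patProb π (τ j)) atTop (𝓝 (1 / (Nat.factorial 4 : ℝ))))
    (u v w u' v' w' : Fin 4) (h1 : u ≠ v) (h2 : w ≠ v) (h3 : u ≠ w)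
    (h1' : u' ≠ v') (h2' : w' ≠ v') (h3' : u' ≠ w') :
    Tendsto (fun j => (∑ p : Fin 4 → Fin (ℓ j), if (p u < p v ∧ p w < p v) ∧
      τ j (p u') < τ j (p v') ∧ τ j (p w') < τ j (p v') then (1 : ℝ) else 0) / (ℓ j : ℝ) ^ 4)
      atTop (𝓝 (1 / 9)) := by
  have := tuple_tendsto hℓ h (fun σ => σ u < σ v ∧ σ w < σ v)
    (fun σ => σ u' < σ v' ∧ σ w' < σ v') (fun j p => (p u < p v ∧ p w < p v) ∧
      τ j (p u') < τ j (p v') ∧ τ j (p w') < τ j (p v')) ?_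
  · convert this using 2
    rw [card_perm_two_lt u v w h1 h2 h3, card_perm_two_lt u' v' w' h1' h2' h3']
    norm_num [Nat.factorial]
  · intro j p σ ρ hσ hρ
    have e := lt_iff_of_strictMono_comp_symm hσ
    have e' := lt_iff_of_strictMono_comp_symm hρ
    simp only [comp_apply] at e'
    rw [e, e, e', e']

end Limits

section Discrepancy

variable {n : ℕ} (τ : Equiv.Perm (Fin n))

/-- The number of points of the graph of `τ` in `[0, x) × [0, y)`. -/
noncomputable def boxCount (x y : ℕ) : ℝ :=
  ∑ i : Fin n, if (i : ℕ) < x ∧ (τ i : ℕ) < y then 1 else 0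

/-- The discrepancy of `τ` on the box `[0, x) × [0, y)`, scaled by the square of the length. -/
noncomputable def disc (x y : ℕ) : ℝ := n * boxCount τ x y - x * y

theorem sum_lt_eq (x : Fin n) : ∑ i : Fin n, (if i < x then (1 : ℝ) else 0) = (x : ℕ) := by
  rw [sum_boole]
  simp [Finset.filter_gt_eq_Iio]

theorem sum_comp_perm_lt_eq (x : Fin n) :
    ∑ i : Fin n, (if τ i < τ x then (1 : ℝ) else 0) = (τ x : ℕ) := by
  rw [← sum_lt_eq (τ x)]
  exact Equiv.sum_comp τ fun i => if i < τ x then (1 : ℝ) else 0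

theorem ite_and_eq_mul (P Q : Prop) [Decidable P] [Decidable Q] :
    (if P ∧ Q then (1 : ℝ) else 0) = (if P then 1 else 0) * (if Q then 1 else 0) := by
  by_cases P <;> by_cases Q <;> simp [*]

theorem boxCount_fin (x y : Fin n) :
    boxCount τ x y = ∑ i : Fin n, (if i < x then 1 else 0) * (if τ i < y then 1 else 0) := by
  simp only [boxCount, Fin.val_fin_lt, ite_and_eq_mul]

theorem sum_quadruple_box_sq :
    (∑ p : Fin 4 → Fin n, if (p 2 < p 0 ∧ p 3 < p 0) ∧
      τ (p 2) < τ (p 1) ∧ τ (p 3) < τ (p 1) then (1 : ℝ) else 0)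
      = ∑ x : Fin n, ∑ y : Fin n, boxCount τ x y ^ 2 := by
  rw [sum_fin_four_arrow fun a b c d => if (c < a ∧ d < a) ∧ τ c < τ b ∧ τ d < τ b
    then (1 : ℝ) else 0]
  refine sum_congr rfl fun a _ => ?_
  rw [← Equiv.sum_comp τ fun y => boxCount τ a y ^ 2]
  refine sum_congr rfl fun b _ => ?_
  rw [boxCount_fin, sq, sum_mul_sum]
  refine sum_congr rfl fun c _ => sum_congr rfl fun d _ => ?_
  simp only [ite_and_eq_mul]
  ring

theorem sum_quadruple_graph_sq :
    (∑ p : Fin 4 → Fin n, if (p 1 < p 0 ∧ p 2 < p 0) ∧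
      τ (p 1) < τ (p 0) ∧ τ (p 2) < τ (p 0) then (1 : ℝ) else 0)
      = n * ∑ x : Fin n, boxCount τ x (τ x) ^ 2 := by
  rw [sum_fin_four_arrow fun a b c d => if (b < a ∧ c < a) ∧ τ b < τ a ∧ τ c < τ a
    then (1 : ℝ) else 0, mul_sum]
  refine sum_congr rfl fun a _ => ?_
  rw [boxCount_fin, sq, sum_mul_sum, mul_sum]
  refine sum_congr rfl fun b _ => ?_
  rw [mul_sum]
  refine sum_congr rfl fun c _ => ?_
  simp only [ite_and_eq_mul, sum_const, card_univ, Fintype.card_fin, nsmul_eq_mul]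
  ring

theorem sum_quadruple_graph_mul :
    (∑ p : Fin 4 → Fin n, if (p 1 < p 0 ∧ p 2 < p 0) ∧
      τ (p 1) < τ (p 0) ∧ τ (p 3) < τ (p 0) then (1 : ℝ) else 0)
      = ∑ x : Fin n, boxCount τ x (τ x) * ((x : ℕ) * (τ x : ℕ)) := by
  rw [sum_fin_four_arrow fun a b c d => if (b < a ∧ c < a) ∧ τ b < τ a ∧ τ d < τ a
    then (1 : ℝ) else 0]
  refine sum_congr rfl fun a _ => ?_
  rw [boxCount_fin, ← sum_lt_eq a, ← sum_comp_perm_lt_eq τ a, sum_mul_sum, sum_mul]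
  refine sum_congr rfl fun b _ => ?_
  rw [mul_sum]
  refine sum_congr rfl fun c _ => ?_
  rw [mul_sum]
  refine sum_congr rfl fun d _ => ?_
  simp only [ite_and_eq_mul]
  ring

theorem sum_fin_val (n : ℕ) : ∑ x : Fin n, ((x : ℕ) : ℝ) = n * (n - 1) / 2 := by
  rw [Fin.sum_univ_eq_sum_range fun x => (x : ℝ)]
  induction n with
  | zero => simp
  | succ m ih => rw [sum_range_succ, ih]; push_cast; ring

theorem sum_fin_val_sq (n : ℕ) :
    ∑ x : Fin n, ((x : ℕ) : ℝ) ^ 2 = n * (n - 1) * (2 * n - 1) / 6 := by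
  rw [Fin.sum_univ_eq_sum_range fun x => (x : ℝ) ^ 2]
  induction n with
  | zero => simp
  | succ m ih => rw [sum_range_succ, ih]; push_cast; ring

theorem sum_gt_val {n : ℕ} (i : Fin n) :
    ∑ x : Fin n, (if i < x then ((x : ℕ) : ℝ) else 0)
      = (n * (n - 1) - (i : ℕ) * ((i : ℕ) + 1)) / 2 := by
  obtain ⟨i, hi⟩ := i
  simp only [Fin.lt_def]
  rw [Fin.sum_univ_eq_sum_range fun x => if i < x then (x : ℝ) else 0]
  induction n, hi using Nat.le_induction with
  | base =>
    rw [sum_eq_zero]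
    · push_cast; ring
    · intro x hx
      rw [mem_range] at hx
      exact if_neg (by omega)
  | succ m hm ih => rw [sum_range_succ, ih, if_pos (by omega)]; push_cast; ring

theorem sum_mul_boxCount :
    4 * ∑ x : Fin n, ∑ y : Fin n, (x : ℕ) * (y : ℕ) * boxCount τ x y =
      ∑ i : Fin n, ((n * (n - 1) - (i : ℕ) * ((i : ℕ) + 1) : ℝ) *
        (n * (n - 1) - (τ i : ℕ) * ((τ i : ℕ) + 1))) := by
  have h : ∀ i : Fin n, ((n * (n - 1) - (i : ℕ) * ((i : ℕ) + 1) : ℝ) *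
        (n * (n - 1) - (τ i : ℕ) * ((τ i : ℕ) + 1)))
      = ∑ x : Fin n, ∑ y : Fin n, 4 * (((x : ℕ) : ℝ) * ((y : ℕ) : ℝ) *
        ((if i < x then 1 else 0) * (if τ i < y then 1 else 0))) := by
    intro i
    have h1 := sum_gt_val i
    have h2 := sum_gt_val (τ i)
    have h3 : ((n * (n - 1) - (i : ℕ) * ((i : ℕ) + 1) : ℝ) *
        (n * (n - 1) - (τ i : ℕ) * ((τ i : ℕ) + 1))) = 4 *
        ((n * (n - 1) - (i : ℕ) * ((i : ℕ) + 1)) / 2 *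
        ((n * (n - 1) - (τ i : ℕ) * ((τ i : ℕ) + 1)) / 2)) := by ring
    rw [h3, ← h1, ← h2, sum_mul_sum, mul_sum]
    refine sum_congr rfl fun x _ => ?_
    rw [mul_sum]
    refine sum_congr rfl fun y _ => ?_
    by_cases hx : i < x <;> by_cases hy : τ i < y <;> simp [hx, hy]
  simp_rw [h, boxCount_fin, mul_sum]
  rw [sum_comm' (t' := univ) (s' := fun _ => univ) (by simp)]
  conv_rhs => rw [sum_comm]
  rw [sum_comm]
  refine sum_congr rfl fun x _ => ?_
  rw [sum_comm]

theorem two_mul_sum_disc_sq_le (hn : 1 ≤ n) :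
    2 * ∑ x : Fin n, ∑ y : Fin n, disc τ x y ^ 2 ≤
      (n : ℝ) ^ 2 * (2 * ∑ x : Fin n, ∑ y : Fin n, boxCount τ x y ^ 2
        + n * ∑ x : Fin n, boxCount τ x (τ x) ^ 2
        - 2 * ∑ x : Fin n, boxCount τ x (τ x) * ((x : ℕ) * (τ x : ℕ)))
      - (n : ℝ) ^ 6 / 9 + (n : ℝ) ^ 5 := by
  have hn' : (1 : ℝ) ≤ n := by exact_mod_cast hn
  have hA : ∑ x : Fin n, ∑ y : Fin n, disc τ x y ^ 2 =
      (n : ℝ) ^ 2 * ∑ x : Fin n, ∑ y : Fin n, boxCount τ x y ^ 2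
      - 2 * n * ∑ x : Fin n, ∑ y : Fin n, (x : ℕ) * (y : ℕ) * boxCount τ x y
      + (∑ x : Fin n, ((x : ℕ) : ℝ) ^ 2) ^ 2 := by
    rw [sq (∑ x : Fin n, ((x : ℕ) : ℝ) ^ 2), sum_mul_sum]
    simp only [mul_sum, ← sum_sub_distrib, ← sum_add_distrib]
    refine sum_congr rfl fun x _ => sum_congr rfl fun y _ => ?_
    rw [disc]; ring
  have hB : 0 ≤ (n : ℝ) ^ 2 * ∑ x : Fin n, boxCount τ x (τ x) ^ 2
      - 2 * n * ∑ x : Fin n, boxCount τ x (τ x) * ((x : ℕ) * (τ x : ℕ))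
      + ∑ x : Fin n, (((x : ℕ) : ℝ) * (τ x : ℕ)) ^ 2 := by
    simp only [mul_sum, ← sum_sub_distrib, ← sum_add_distrib]
    refine sum_nonneg fun x _ => ?_
    have := sq_nonneg (disc τ x (τ x))
    rw [disc] at this
    linarith
  have hq : ∑ x : Fin n, (((x : ℕ) : ℝ) * ((x : ℕ) + 1)) = n * (n - 1) * (n + 1) / 3 := by
    have : ∀ x : Fin n, ((x : ℕ) : ℝ) * ((x : ℕ) + 1) = ((x : ℕ) : ℝ) ^ 2 + (x : ℕ) :=
      fun x => by ring
    simp only [this, sum_add_distrib, sum_fin_val, sum_fin_val_sq]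
    ring
  have hq' : ∑ x : Fin n, (((τ x : ℕ) : ℝ) * ((τ x : ℕ) + 1)) = n * (n - 1) * (n + 1) / 3 := by
    rw [← hq]
    exact Equiv.sum_comp τ fun x => ((x : ℕ) : ℝ) * ((x : ℕ) + 1)
  have hC : 4 * ∑ x : Fin n, ∑ y : Fin n, (x : ℕ) * (y : ℕ) * boxCount τ x y =
      n * (n * (n - 1)) ^ 2 - 2 * (n * (n - 1)) * (n * (n - 1) * (n + 1) / 3)
      + ∑ x : Fin n, (((x : ℕ) : ℝ) * ((x : ℕ) + 1)) * (((τ x : ℕ) : ℝ) * ((τ x : ℕ) + 1)) := by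
    rw [sum_mul_boxCount]
    have e : ∀ a b N : ℝ, (N - a) * (N - b) = N ^ 2 - N * a - N * b + a * b :=
      fun a b N => by ring
    simp only [e, sum_add_distrib, sum_sub_distrib, ← mul_sum, hq, hq', sum_const, card_univ,
      Fintype.card_fin, nsmul_eq_mul]
    ring
  have hM : ∑ x : Fin n, (((x : ℕ) : ℝ) * (τ x : ℕ)) ^ 2 ≤
      ∑ x : Fin n, (((x : ℕ) : ℝ) * ((x : ℕ) + 1)) * (((τ x : ℕ) : ℝ) * ((τ x : ℕ) + 1)) := by
    refine sum_le_sum fun x _ => ?_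
    have h1 : (0 : ℝ) ≤ (x : ℕ) := Nat.cast_nonneg _
    have h2 : (0 : ℝ) ≤ (τ x : ℕ) := Nat.cast_nonneg _
    generalize ((x : ℕ) : ℝ) = a at *
    generalize ((τ x : ℕ) : ℝ) = b at *
    have : 0 ≤ a * b * (a + b + 1) := by positivity
    nlinarith
  rw [sum_fin_val_sq] at hA
  generalize (∑ x : Fin n, ∑ y : Fin n, disc τ x y ^ 2) = A at *
  generalize (∑ x : Fin n, ∑ y : Fin n, boxCount τ x y ^ 2) = S1 at *
  generalize (∑ x : Fin n, boxCount τ x (τ x) ^ 2) = S2 at *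
  generalize (∑ x : Fin n, boxCount τ x (τ x) * ((x : ℕ) * (τ x : ℕ)) : ℝ) = S3 at *
  generalize (∑ x : Fin n, ∑ y : Fin n, (x : ℕ) * (y : ℕ) * boxCount τ x y : ℝ) = T at *
  generalize (∑ x : Fin n, (((x : ℕ) : ℝ) * (τ x : ℕ)) ^ 2) = M at *
  generalize (∑ x : Fin n, (((x : ℕ) : ℝ) * ((x : ℕ) + 1)) *
    (((τ x : ℕ) : ℝ) * ((τ x : ℕ) + 1))) = M' at *
  generalize (n : ℝ) = N at *
  have hT : T =
      (N * (N * (N - 1)) ^ 2 - 2 * (N * (N - 1)) * (N * (N - 1) * (N + 1) / 3) + M') / 4 := by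
    linarith
  have h1 : N * M ≤ N * M' := mul_le_mul_of_nonneg_left hM (by linarith)
  have h2 := mul_nonneg (by linarith : 0 ≤ N) hB
  have h3 : N ^ 2 * (N - 1) ^ 2 * (-N ^ 2 / 9 + 4 * N / 9 + 1 / 18) ≤ - N ^ 6 / 9 + N ^ 5 := by
    obtain ⟨m, rfl⟩ : ∃ m, N = m + 1 := ⟨N - 1, by ring⟩
    have hm : 0 ≤ m := by linarith
    have : 0 ≤ - (m + 1) ^ 6 / 9 + (m + 1) ^ 5 - ((m + 1) ^ 2 * (m + 1 - 1) ^ 2 *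
      (-(m + 1) ^ 2 / 9 + 4 * (m + 1) / 9 + 1 / 18)) := by
      ring_nf
      positivity
    linarith
  rw [hA, hT]
  nlinarith

end Discrepancy

section Uniform

variable {n : ℕ} (τ : Equiv.Perm (Fin n))

theorem boxCount_symm (x y : ℕ) : boxCount τ.symm y x = boxCount τ x y := by
  unfold boxCount
  rw [← Equiv.sum_comp τ]
  simp only [Equiv.symm_apply_apply, and_comm]

theorem disc_symm (x y : ℕ) : disc τ.symm y x = disc τ x y := by
  rw [disc, disc, boxCount_symm, mul_comm (x : ℝ)]

theorem sum_val_lt {x : ℕ} (hx : x ≤ n) :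
    ∑ i : Fin n, (if (i : ℕ) < x then (1 : ℝ) else 0) = x := by
  rw [Fin.sum_univ_eq_sum_range fun i => if i < x then (1 : ℝ) else 0, sum_boole]
  have : (range n).filter (· < x) = range x := by
    ext i; simp only [mem_filter, mem_range]; omega
  rw [this, card_range]

theorem abs_disc_sub_le {x x' y : ℕ} (hx : x ≤ x') (hx' : x' ≤ n) (hy : y ≤ n) :
    |disc τ x' y - disc τ x y| ≤ n * ((x' : ℝ) - x) := by
  have h : boxCount τ x' y - boxCount τ x y ∈ Set.Icc (0 : ℝ) (x' - x) := by
    rw [← sum_val_lt hx', ← sum_val_lt (hx.trans hx'), boxCount, boxCount, ← sum_sub_distrib,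
      ← sum_sub_distrib]
    constructor
    · refine sum_nonneg fun i _ => ?_
      split_ifs <;> first | (exfalso; omega) | norm_num
    · refine sum_le_sum fun i _ => ?_
      split_ifs <;> first | (exfalso; omega) | norm_num
  obtain ⟨h1, h2⟩ := h
  have hn : (0 : ℝ) ≤ n := Nat.cast_nonneg _
  have hy' : (y : ℝ) ≤ n := by exact_mod_cast hy
  have hy0 : (0 : ℝ) ≤ y := Nat.cast_nonneg _
  have hxx : (0 : ℝ) ≤ (x' : ℝ) - x := by
    rw [sub_nonneg]; exact_mod_cast hx
  have e : disc τ x' y - disc τ x y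
      = n * (boxCount τ x' y - boxCount τ x y) - (x' - x) * y := by
    rw [disc, disc]; ring
  rw [e, abs_le]
  have h3 := mul_le_mul_of_nonneg_left h2 hn
  have h4 := mul_nonneg hn h1
  have h5 := mul_le_mul_of_nonneg_left hy' hxx
  have h6 := mul_nonneg hxx hy0
  constructor <;> linarith

theorem disc_zero_left (y : ℕ) : disc τ 0 y = 0 := by
  simp [disc, boxCount]

theorem abs_disc_le {x y : ℕ} (hx : x ≤ n) (hy : y ≤ n) : |disc τ x y| ≤ n * x := by
  simpa [disc_zero_left] using abs_disc_sub_le τ (Nat.zero_le x) hx hy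

theorem le_sum_disc_sq {x₀ y₀ m : ℕ} (hn : 1 ≤ n) (hx : x₀ ≤ n) (hy : y₀ ≤ n)
    (h : 4 * m * n ≤ |disc τ x₀ y₀|) :
    4 * (m : ℝ) ^ 4 * (n : ℝ) ^ 2 ≤ ∑ x : Fin n, ∑ y : Fin n, disc τ x y ^ 2 := by
  have hn0 : (0 : ℝ) < n := by exact_mod_cast hn
  have hmx : m ≤ x₀ := by
    have h1 := h.trans (abs_disc_le τ hx hy)
    have h2 : (4 * m : ℝ) ≤ x₀ := by nlinarith
    have : 4 * m ≤ x₀ := by exact_mod_cast h2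
    omega
  have hmy : m ≤ y₀ := by
    rw [← disc_symm] at h
    have h1 := h.trans (abs_disc_le τ.symm hy hx)
    have h2 : (4 * m : ℝ) ≤ y₀ := by nlinarith
    have : 4 * m ≤ y₀ := by exact_mod_cast h2
    omega
  have e : ∑ x : Fin n, ∑ y : Fin n, disc τ x y ^ 2
      = ∑ x ∈ range n, ∑ y ∈ range n, disc τ x y ^ 2 := by
    rw [← Fin.sum_univ_eq_sum_range fun x => ∑ y ∈ range n, disc τ x y ^ 2]
    exact sum_congr rfl fun x _ => Fin.sum_univ_eq_sum_range (fun y => disc τ x y ^ 2) n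
  have key : ∀ x ∈ Ico (x₀ - m) x₀, ∀ y ∈ Ico (y₀ - m) y₀,
      (2 * m * n : ℝ) ^ 2 ≤ disc τ x y ^ 2 := by
    intro x hxm y hym
    rw [mem_Ico] at hxm hym
    have h1 := abs_disc_sub_le τ hxm.2.le hx (hym.2.le.trans hy)
    have h2 := abs_disc_sub_le τ.symm hym.2.le hy hx
    rw [disc_symm, disc_symm] at h2
    have h3 : (x₀ : ℝ) - x ≤ m := by
      rw [sub_le_iff_le_add]; norm_cast; omega
    have h4 : (y₀ : ℝ) - y ≤ m := by
      rw [sub_le_iff_le_add]; norm_cast; omega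
    have h5 := mul_le_mul_of_nonneg_left h3 hn0.le
    have h6 := mul_le_mul_of_nonneg_left h4 hn0.le
    have h7 : |disc τ x₀ y₀| ≤
        |disc τ x₀ y₀ - disc τ x₀ y| + |disc τ x₀ y - disc τ x y| + |disc τ x y| := by
      have := abs_add_three (disc τ x₀ y₀ - disc τ x₀ y) (disc τ x₀ y - disc τ x y) (disc τ x y)
      simpa using this
    rw [← sq_abs (disc τ x y)]
    refine pow_le_pow_left₀ (by positivity) ?_ 2
    linarith
  rw [e]
  calc 4 * (m : ℝ) ^ 4 * (n : ℝ) ^ 2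
      = ∑ x ∈ Ico (x₀ - m) x₀, ∑ y ∈ Ico (y₀ - m) y₀, (2 * m * n : ℝ) ^ 2 := by
        simp only [sum_const, Nat.card_Ico, Nat.sub_sub_self hmx, Nat.sub_sub_self hmy,
          nsmul_eq_mul]
        ring
    _ ≤ ∑ x ∈ Ico (x₀ - m) x₀, ∑ y ∈ Ico (y₀ - m) y₀, disc τ x y ^ 2 :=
        sum_le_sum fun x hxm => sum_le_sum fun y hym => key x hxm y hym
    _ ≤ ∑ x ∈ Ico (x₀ - m) x₀, ∑ y ∈ range n, disc τ x y ^ 2 := by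
        refine sum_le_sum fun x _ => sum_le_sum_of_subset_of_nonneg ?_ fun _ _ _ => sq_nonneg _
        intro y; simp only [mem_Ico, mem_range]; omega
    _ ≤ ∑ x ∈ range n, ∑ y ∈ range n, disc τ x y ^ 2 := by
        refine sum_le_sum_of_subset_of_nonneg ?_ fun _ _ _ => sum_nonneg fun _ _ => sq_nonneg _
        intro y; simp only [mem_Ico, mem_range]; omega

end Uniform

section UniformLimit

variable {ℓ : ℕ → ℕ} {τ : ∀ j, Equiv.Perm (Fin (ℓ j))}

theorem sum_disc_sq_tendsto (hℓ : Tendsto ℓ atTop atTop)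
    (h : ∀ π : Equiv.Perm (Fin 4),
      Tendsto (fun j => patProb π (τ j)) atTop (𝓝 (1 / (Nat.factorial 4 : ℝ)))) :
    Tendsto (fun j => (∑ x : Fin (ℓ j), ∑ y : Fin (ℓ j), disc (τ j) x y ^ 2) / (ℓ j : ℝ) ^ 6)
      atTop (𝓝 0) := by
  have h1 := quadruple_tendsto hℓ h 2 0 3 2 1 3 (by decide) (by decide) (by decide) (by decide)
    (by decide) (by decide)
  have h2 := quadruple_tendsto hℓ h 1 0 2 1 0 2 (by decide) (by decide) (by decide) (by decide)
    (by decide) (by decide)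
  have h3 := quadruple_tendsto hℓ h 1 0 2 1 0 3 (by decide) (by decide) (by decide) (by decide)
    (by decide) (by decide)
  have h4 : Tendsto (fun j => ((ℓ j : ℝ))⁻¹) atTop (𝓝 0) :=
    tendsto_inv_atTop_nhds_zero_nat.comp hℓ
  have h5 := ((((h1.const_mul 2).add h2).sub (h3.const_mul 2)).sub_const (1 / 9)).add h4
  have h6 := h5.div_const 2
  norm_num only at h6
  refine squeeze_zero' (Eventually.of_forall fun j => by positivity) ?_ h6
  filter_upwards [hℓ.eventually_ge_atTop 1] with j hj
  have hj' : (0 : ℝ) < ℓ j := by exact_mod_cast hj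
  have := two_mul_sum_disc_sq_le (τ j) hj
  rw [sum_quadruple_box_sq, sum_quadruple_graph_sq, sum_quadruple_graph_mul]
  rw [div_le_iff₀ (by positivity)]
  generalize (∑ x : Fin (ℓ j), boxCount (τ j) x (τ j x) * ((x : ℕ) * (τ j x : ℕ)) : ℝ) = S at *
  field_simp
  linarith

theorem eventually_abs_disc_le (hℓ : Tendsto ℓ atTop atTop)
    (h : ∀ π : Equiv.Perm (Fin 4),
      Tendsto (fun j => patProb π (τ j)) atTop (𝓝 (1 / (Nat.factorial 4 : ℝ))))
    {δ : ℝ} (hδ : 0 < δ) :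
    ∀ᶠ j in atTop, ∀ x ≤ ℓ j, ∀ y ≤ ℓ j, |disc (τ j) x y| ≤ δ * (ℓ j : ℝ) ^ 2 := by
  have h1 := (sum_disc_sq_tendsto hℓ h).eventually_lt_const
    (show 0 < 4 * (δ / 8) ^ 4 by positivity)
  have h2 := (tendsto_natCast_atTop_atTop (R := ℝ)).comp hℓ |>.eventually_ge_atTop (8 / δ)
  filter_upwards [h1, h2, hℓ.eventually_ge_atTop 1] with j hj1 hj2 hj3 x hx y hy
  by_contra! hc
  have hj' : (0 : ℝ) < ℓ j := by exact_mod_cast hj3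
  rw [div_lt_iff₀ (by positivity)] at hj1
  have hm := Nat.floor_le (show 0 ≤ δ * ℓ j / 4 by positivity)
  have hm' := Nat.lt_floor_add_one (δ * ℓ j / 4)
  set m := ⌊δ * ℓ j / 4⌋₊
  have h3 : δ / 8 * ℓ j ≤ m := by
    have : 8 ≤ δ * ℓ j := by
      have := (div_le_iff₀ hδ).1 hj2
      simp only [comp_apply] at this
      linarith
    linarith
  have h4 := le_sum_disc_sq (τ j) (m := m) hj3 hx hy (by nlinarith)
  have h5 : 4 * (δ / 8 * ℓ j) ^ 4 * (ℓ j : ℝ) ^ 2 ≤ 4 * (m : ℝ) ^ 4 * (ℓ j : ℝ) ^ 2 := by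
    gcongr
  nlinarith

end UniformLimit

section Replacement

theorem abs_sum_prod_sub_sum_prod_le {ι G : Type*} [Fintype ι] [DecidableEq ι] [Fintype G] {μ ν : G → ℝ}
    (hμ : ∀ v, 0 ≤ μ v) (hν : ∀ v, 0 ≤ ν v) (hμ1 : ∑ v, μ v = 1) (hν1 : ∑ v, ν v = 1)
    (K : (ι → G) → ℝ) {η : ℝ}
    (h : ∀ a p, |∑ v, (μ v - ν v) * K (update p a v)| ≤ η) :
    |∑ p, (∏ i, μ (p i)) * K p - ∑ p, (∏ i, ν (p i)) * K p| ≤ Fintype.card ι * η := by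
  let w : Finset ι → ι → G → ℝ := fun S i v => if i ∈ S then μ v else ν v
  have hw : ∀ S i v, 0 ≤ w S i v := fun S i v => by
    simp only [w]; split_ifs <;> simp [hμ, hν]
  have hw1 : ∀ S i, ∑ v, w S i v = 1 := fun S i => by
    simp only [w]; split_ifs <;> simp [hμ1, hν1]
  obtain ⟨v₀⟩ : Nonempty G := by
    by_contra hG
    rw [not_nonempty_iff] at hG
    simp at hμ1
  have key : ∀ S : Finset ι,
      |∑ p, (∏ i, w S i (p i)) * K p - ∑ p, (∏ i, ν (p i)) * K p| ≤ #S * η := by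
    intro S
    induction S using Finset.induction_on with
    | empty => simp [w]
    | insert a S ha ih =>
      have step : |∑ p, (∏ i, w (insert a S) i (p i)) * K p - ∑ p, (∏ i, w S i (p i)) * K p|
          ≤ η := by
        have e : ∑ p, (∏ i, w (insert a S) i (p i)) * K p - ∑ p, (∏ i, w S i (p i)) * K p
            = ∑ q : {j // j ≠ a} → G, (∏ j : {j // j ≠ a}, w S j (q j)) *
              ∑ v, (μ v - ν v) * K (update ((Equiv.funSplitAt a G).symm (v₀, q)) a v) := by
          rw [← sum_sub_distrib, ← Equiv.sum_comp (Equiv.funSplitAt a G).symm,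
            Fintype.sum_prod_type_right]
          refine sum_congr rfl fun q _ => ?_
          rw [mul_sum]
          refine sum_congr rfl fun v _ => ?_
          have hu : update ((Equiv.funSplitAt a G).symm (v₀, q)) a v
              = (Equiv.funSplitAt a G).symm (v, q) := by
            ext i
            by_cases hi : i = a
            · subst hi; simp [Equiv.funSplitAt, Equiv.piSplitAt]
            · simp [Equiv.funSplitAt, Equiv.piSplitAt, hi]
          rw [hu, Fintype.prod_eq_mul_prod_subtype_ne _ a, Fintype.prod_eq_mul_prod_subtype_ne _ a]
          have h1 : ∀ j : {j // j ≠ a}, w (insert a S) j ((Equiv.funSplitAt a G).symm (v, q) j)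
              = w S j (q j) := fun j => by
            simp [w, j.2, Equiv.funSplitAt, Equiv.piSplitAt]
          have h2 : ∀ j : {j // j ≠ a}, w S j ((Equiv.funSplitAt a G).symm (v, q) j)
              = w S j (q j) := fun j => by
            simp [w, j.2, Equiv.funSplitAt, Equiv.piSplitAt]
          have h3 : (Equiv.funSplitAt a G).symm (v, q) a = v := by
            simp [Equiv.funSplitAt, Equiv.piSplitAt]
          have h4 : w (insert a S) a v = μ v := by simp [w]
          have h5 : w S a v = ν v := by simp [w, ha]
          rw [prod_congr rfl fun j _ => h1 j, prod_congr rfl fun j _ => h2 j, h3, h4, h5]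
          ring
        rw [e]
        calc _ ≤ ∑ q : {j // j ≠ a} → G, (∏ j : {j // j ≠ a}, w S j (q j)) * η := by
              refine (abs_sum_le_sum_abs _ _).trans (sum_le_sum fun q _ => ?_)
              rw [abs_mul, abs_of_nonneg (prod_nonneg fun (j : {j // j ≠ a}) _ => hw S j (q j))]
              exact mul_le_mul_of_nonneg_left (h _ _) (prod_nonneg fun (j : {j // j ≠ a}) _ => hw S j (q j))
          _ = η := by
              rw [← sum_mul, ← Fintype.piFinset_univ,
                ← prod_univ_sum (fun _ => univ) fun (j : {j // j ≠ a}) v => w S j v]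
              simp [hw1]
      rw [card_insert_of_notMem ha]
      push_cast
      have := abs_sub_le (∑ p, (∏ i, w (insert a S) i (p i)) * K p)
        (∑ p, (∏ i, w S i (p i)) * K p) (∑ p, (∏ i, ν (p i)) * K p)
      linarith
  simpa [w] using key univ

end Replacement

section Counting

variable {n k : ℕ} (τ : Equiv.Perm (Fin n)) (π : Equiv.Perm (Fin k))

/-- The uniform probability weight on the graph of `τ`. -/
noncomputable def graphWeight (v : Fin n × Fin n) : ℝ := if τ v.1 = v.2 then 1 / n else 0

theorem sum_graphWeight_mul (f : Fin n × Fin n → ℝ) :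
    ∑ v, graphWeight τ v * f v = 1 / n * ∑ i, f (i, τ i) := by
  rw [Fintype.sum_prod_type, mul_sum]
  refine sum_congr rfl fun i _ => ?_
  rw [sum_eq_single (τ i)]
  · simp [graphWeight]
  · intro y _ hy
    simp [graphWeight, hy.symm]
  · simp

theorem sum_weight_sub_mul_box {x y : ℕ} (hn : 1 ≤ n) (hx : x ≤ n) (hy : y ≤ n) :
    ∑ v : Fin n × Fin n, (graphWeight τ v - 1 / (n : ℝ) ^ 2) *
      ((if (v.1 : ℕ) < x then 1 else 0) * (if (v.2 : ℕ) < y then 1 else 0))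
      = disc τ x y / (n : ℝ) ^ 2 := by
  have hn0 : (0 : ℝ) < n := by exact_mod_cast hn
  have h : ∑ v : Fin n × Fin n, ((if (v.1 : ℕ) < x then (1 : ℝ) else 0) *
      (if (v.2 : ℕ) < y then 1 else 0)) = x * y := by
    rw [← sum_val_lt hx, ← sum_val_lt hy, Fintype.sum_mul_sum, Fintype.sum_prod_type]
  simp only [sub_mul, sum_sub_distrib, sum_graphWeight_mul]
  rw [← mul_sum, h]
  simp only [← ite_and_eq_mul]
  rw [disc, boxCount]
  field_simp

theorem exists_ite_eq_sub_of_ordConnected (P : Fin n → Prop)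
    (hP : ∀ r s t, r ≤ s → s ≤ t → P r → P t → P s) :
    ∃ a b : ℕ, a ≤ n ∧ b ≤ n ∧ ∀ s : Fin n, (if P s then (1 : ℝ) else 0)
      = (if (s : ℕ) < b then 1 else 0) - (if (s : ℕ) < a then 1 else 0) := by
  by_cases hne : (univ.filter P).Nonempty
  · have ha := min'_mem _ hne
    have hb := max'_mem _ hne
    have hle : ∀ s, P s → (univ.filter P).min' hne ≤ s ∧ s ≤ (univ.filter P).max' hne :=
      fun s hs => ⟨min'_le _ _ (by simpa using hs), le_max' _ _ (by simpa using hs)⟩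
    simp only [mem_filter, mem_univ, true_and] at ha hb
    generalize (univ.filter P).min' hne = a at *
    generalize (univ.filter P).max' hne = b at *
    refine ⟨a, b + 1, a.2.le, b.2, fun s => ?_⟩
    have hs : P s ↔ (a : ℕ) ≤ s ∧ (s : ℕ) ≤ b :=
      ⟨hle s, fun h => hP a s b h.1 h.2 ha hb⟩
    have hab : (a : ℕ) ≤ b := (hle b hb).1
    rw [if_congr hs rfl rfl]
    split_ifs <;> first | (exfalso; omega) | norm_num
  · refine ⟨0, 0, Nat.zero_le _, Nat.zero_le _, fun s => ?_⟩
    have : ¬ P s := fun h => hne ⟨s, by simpa using h⟩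
    simp [this]

theorem abs_sum_weight_sub_mul_le (hn : 1 ≤ n) {δ : ℝ}
    (hδ : ∀ x ≤ n, ∀ y ≤ n, |disc τ x y| ≤ δ * (n : ℝ) ^ 2) (P Q : Fin n → Prop)
    (hP : ∀ r s t, r ≤ s → s ≤ t → P r → P t → P s)
    (hQ : ∀ r s t, r ≤ s → s ≤ t → Q r → Q t → Q s) :
    |∑ v : Fin n × Fin n, (graphWeight τ v - 1 / (n : ℝ) ^ 2) *
      (if P v.1 ∧ Q v.2 then 1 else 0)| ≤ 4 * δ := by
  obtain ⟨a, b, ha, hb, hab⟩ := exists_ite_eq_sub_of_ordConnected P hP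
  obtain ⟨c, d, hc, hd, hcd⟩ := exists_ite_eq_sub_of_ordConnected Q hQ
  have hn0 : (0 : ℝ) < n := by exact_mod_cast hn
  have e : ∑ v : Fin n × Fin n, (graphWeight τ v - 1 / (n : ℝ) ^ 2) *
      (if P v.1 ∧ Q v.2 then 1 else 0)
      = disc τ b d / (n : ℝ) ^ 2 - disc τ a d / (n : ℝ) ^ 2 - disc τ b c / (n : ℝ) ^ 2
        + disc τ a c / (n : ℝ) ^ 2 := by
    rw [← sum_weight_sub_mul_box τ hn hb hd, ← sum_weight_sub_mul_box τ hn ha hd,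
      ← sum_weight_sub_mul_box τ hn hb hc, ← sum_weight_sub_mul_box τ hn ha hc,
      ← sum_sub_distrib, ← sum_sub_distrib, ← sum_add_distrib]
    refine sum_congr rfl fun v _ => ?_
    rw [ite_and_eq_mul, hab, hcd]
    ring
  have h : ∀ x ≤ n, ∀ y ≤ n, |disc τ x y / (n : ℝ) ^ 2| ≤ δ := fun x hx y hy => by
    rw [abs_div, abs_of_pos (by positivity : 0 < (n : ℝ) ^ 2), div_le_iff₀ (by positivity)]
    exact hδ x hx y hy
  have h1 := abs_le.1 (h b hb d hd)
  have h2 := abs_le.1 (h a ha d hd)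
  have h3 := abs_le.1 (h b hb c hc)
  have h4 := abs_le.1 (h a ha c hc)
  rw [e, abs_le]
  constructor <;> linarith

theorem strictMono_update_of_mem_between {x : Fin k → Fin n} {a : Fin k} {r s t : Fin n}
    (hrs : r ≤ s) (hst : s ≤ t) (hr : StrictMono (update x a r))
    (ht : StrictMono (update x a t)) : StrictMono (update x a s) := by
  intro i j hij
  have h1 := hr hij
  have h2 := ht hij
  by_cases hi : i = a
  · subst hi
    simp only [update_self, update_of_ne hij.ne'] at *
    exact hst.trans_lt h2
  · by_cases hj : j = a
    · subst hj
      simp only [update_self, update_of_ne hij.ne] at *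
      exact h1.trans_le hrs
    · simpa only [update_of_ne hi, update_of_ne hj] using h1

theorem sum_arrow_prod (f : (Fin k → Fin n) → (Fin k → Fin n) → ℝ) :
    ∑ p : Fin k → Fin n × Fin n, f (fun i => (p i).1) (fun i => (p i).2)
      = ∑ x, ∑ y, f x y := by
  rw [← Fintype.sum_prod_type']
  exact Fintype.sum_equiv (Equiv.arrowProdEquivProdArrow (Fin k) (fun _ => Fin n) fun _ => Fin n)
    _ _ fun p => rfl

/-- The indicator function of the point configurations forming the pattern `π`. -/
noncomputable def patternIndicator (p : Fin k → Fin n × Fin n) : ℝ :=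
  if StrictMono (fun i => (p i).1) ∧ StrictMono ((fun i => (p i).2) ∘ π.symm) then 1 else 0

theorem abs_patCount_div_sub_le (hn : 1 ≤ n) {δ : ℝ}
    (hδ : ∀ x ≤ n, ∀ y ≤ n, |disc τ x y| ≤ δ * (n : ℝ) ^ 2) :
    |patCount π τ / (n : ℝ) ^ k - ((n.choose k : ℝ) / (n : ℝ) ^ k) ^ 2| ≤ k * (4 * δ) := by
  have hn0 : (0 : ℝ) < n := by exact_mod_cast hn
  have h := abs_sum_prod_sub_sum_prod_le (ι := Fin k) (μ := graphWeight τ)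
    (ν := fun _ => 1 / (n : ℝ) ^ 2) (η := 4 * δ)
    (fun v => by unfold graphWeight; split_ifs <;> positivity) (fun v => by positivity)
    (by simpa [hn0.ne'] using sum_graphWeight_mul τ fun _ => 1)
    (by simp; field_simp)
    (patternIndicator π) ?_
  · have h1 : ∑ p : Fin k → Fin n × Fin n, (∏ i, graphWeight τ (p i)) *
        patternIndicator π p = patCount π τ / (n : ℝ) ^ k := by
      unfold patternIndicator
      rw [sum_arrow_prod fun x y => (∏ i, graphWeight τ (x i, y i)) *
        (if StrictMono x ∧ StrictMono (y ∘ π.symm) then 1 else 0), patCount, sum_div]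
      refine sum_congr rfl fun x _ => ?_
      rw [sum_eq_single (τ ∘ x)]
      · simp [graphWeight, comp_assoc, div_eq_inv_mul]
      · intro y _ hy
        obtain ⟨i, hi⟩ := Function.ne_iff.1 hy
        rw [prod_eq_zero (mem_univ i), zero_mul]
        exact if_neg fun e => hi e.symm
      · simp
    have h2 : ∑ p : Fin k → Fin n × Fin n, (∏ _i : Fin k, 1 / (n : ℝ) ^ 2) *
        patternIndicator π p = ((n.choose k : ℝ) / (n : ℝ) ^ k) ^ 2 := by
      unfold patternIndicator
      rw [sum_arrow_prod fun x y => (∏ _i : Fin k, 1 / (n : ℝ) ^ 2) *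
        (if StrictMono x ∧ StrictMono (y ∘ π.symm) then 1 else 0)]
      have h3 : ∑ y : Fin k → Fin n, (if StrictMono (y ∘ π.symm) then (1 : ℝ) else 0)
          = n.choose k := by
        rw [← card_strictMono]
        exact Fintype.sum_equiv (π.arrowCongr (Equiv.refl _)) _ _ fun p => rfl
      simp only [ite_and_eq_mul, ← mul_sum, ← sum_mul, h3, card_strictMono]
      simp
      field_simp
      ring
    rw [h1, h2] at h
    simpa using h
  · intro a p
    have e : ∀ v : Fin n × Fin n, patternIndicator π (update p a v) =
        if StrictMono (update (fun i => (p i).1) a v.1) ∧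
          StrictMono (update ((fun i => (p i).2) ∘ π.symm) (π a) v.2) then 1 else 0 := by
      intro v
      have e1 : (fun i => (update p a v i).1) = update (fun i => (p i).1) a v.1 := by
        ext i; by_cases hi : i = a
        · subst hi; simp
        · simp [hi]
      have e2 : (fun i => (update p a v i).2) ∘ π.symm
          = update ((fun i => (p i).2) ∘ π.symm) (π a) v.2 := by
        ext i; by_cases hi : i = π a
        · subst hi; simp
        · have : π.symm i ≠ a := fun h => hi (by simp [← h])
          simp [hi, this]
      simp only [patternIndicator, e1, e2]
    simp only [e]
    convert abs_sum_weight_sub_mul_le τ hn hδ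
      (fun s => StrictMono (update (fun i => (p i).1) a s))
      (fun s => StrictMono (update ((fun i => (p i).2) ∘ π.symm) (π a) s))
      (fun _ _ _ h1 h2 => strictMono_update_of_mem_between h1 h2)
      (fun _ _ _ h1 h2 => strictMono_update_of_mem_between h1 h2)

end Counting

/-- **Property P(4) implies Property P(k) for all k ≥ 2** (Král'–Pikhurko).
If `(τ_j)` is a sequence of permutations whose lengths tend to infinity and
`t(π, τ_j) → 1/24` for every `π ∈ S₄`, then for every `k ≥ 2` and every `π ∈ S_k`,
`t(π, τ_j) → 1/k!`. -/
theorem P4_implies_Pk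
    (ℓ : ℕ → ℕ) (τ : ∀ j, Equiv.Perm (Fin (ℓ j)))
    (hℓ : Filter.Tendsto ℓ Filter.atTop Filter.atTop)
    (h4 : ∀ π : Equiv.Perm (Fin 4),
      Filter.Tendsto (fun j => patProb π (τ j)) Filter.atTop
        (nhds (1 / (Nat.factorial 4 : ℝ)))) :
    ∀ k : ℕ, 2 ≤ k → ∀ π : Equiv.Perm (Fin k),
      Filter.Tendsto (fun j => patProb π (τ j)) Filter.atTop
        (nhds (1 / (Nat.factorial k : ℝ))) := by
  intro k hk π
  have hc := (choose_div_pow_tendsto k).comp hℓ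
  have h1 : Tendsto (fun j => patCount π (τ j) / (ℓ j : ℝ) ^ k
      - (((ℓ j).choose k : ℝ) / (ℓ j : ℝ) ^ k) ^ 2) atTop (𝓝 0) := by
    rw [Metric.tendsto_nhds]
    intro ε hε
    have hk' : (0 : ℝ) < k := by exact_mod_cast (by omega : 0 < k)
    filter_upwards [eventually_abs_disc_le hℓ h4 (show 0 < ε / (8 * k) by positivity),
      hℓ.eventually_ge_atTop 1] with j hj hj1
    rw [Real.dist_0_eq_abs]
    refine (abs_patCount_div_sub_le (τ j) π hj1 hj).trans_lt ?_
    field_simp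
    linarith
  have hf : (k.factorial : ℝ) ≠ 0 := by positivity
  have h2 := (h1.add (hc.pow 2)).div hc (by positivity)
  have e : (0 + (1 / (k.factorial : ℝ)) ^ 2) / (1 / (k.factorial : ℝ)) = 1 / k.factorial := by
    field_simp
    simp
  rw [e] at h2
  refine h2.congr' ?_
  filter_upwards [hℓ.eventually_ge_atTop k] with j hj
  have hpos : ((ℓ j).choose k : ℝ) ≠ 0 := by exact_mod_cast (Nat.choose_pos hj).ne'
  have hj' : (ℓ j : ℝ) ≠ 0 := by exact_mod_cast (by omega : ℓ j ≠ 0)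
  simp only [patProb_eq, comp_apply, Pi.div_apply, sub_add_cancel]
  field_simp

end QuasirandomPerm
end
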